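/- arXiv:math/0504281 — 4 statements merged into one kernel-verified Lean document; each statement's English description precedes it below -/
import Mathlib

section
/- Let G be a finite group, let k ⊆ k' be an algebraic extension of fields, and let M and N be finitely generated kG-modules. If the base changes k' ⊗_k M and k' ⊗_k N are isomorphic as k'G-modules, then M and N are isomorphic as kG-modules. -/
open TensorProduct

/-- The base change of a representation `ρ : Representation k G V` to a field extension `k'`:
`G` acts on `k' ⊗[k] V` through the second tensor factor. -/
noncomputable def repBaseChange {k G V : Type*} [CommRing k] (k' : Type*) [CommRing k']
    [Algebra k k'] [Monoid G] [AddCommGroup V] [Module k V]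
    (ρ : Representation k G V) : Representation k' G (k' ⊗[k] V) where
  toFun g := (ρ g).baseChange k'
  map_one' := by
    simp only [map_one]
    exact LinearMap.baseChange_one k V
  map_mul' g h := by
    simp only [map_mul]
    exact LinearMap.baseChange_mul (ρ g) (ρ h)

open Module

universe w

section HomCounting

variable {R : Type*} [Ring R]

/-- Linear maps with kernel `K` correspond to injective linear maps out of the quotient by `K`. -/
def LinearMap.kerEqEquivInjective {X M : Type*} [AddCommGroup X] [Module R X] [AddCommGroup M]
    [Module R M] (K : Submodule R X) :
    {f : X →ₗ[R] M // LinearMap.ker f = K} ≃ {g : (X ⧸ K) →ₗ[R] M // Function.Injective g} where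
  toFun f := ⟨K.liftQ f.1 f.2.ge,
    LinearMap.ker_eq_bot.1 (Submodule.ker_liftQ_eq_bot _ _ _ f.2.le)⟩
  invFun g := ⟨g.1 ∘ₗ K.mkQ, by
    rw [LinearMap.ker_comp, LinearMap.ker_eq_bot.2 g.2, Submodule.comap_bot, Submodule.ker_mkQ]⟩
  left_inv f := Subtype.ext (K.liftQ_mkQ f.1 f.2.ge)
  right_inv g := Subtype.ext (by ext; rfl)

/-- Sorting linear maps out of a finite module by their kernels. -/
theorem LinearMap.natCard_eq_sum_injective {X M : Type*} [AddCommGroup X] [Module R X]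
    [AddCommGroup M] [Module R M] [Finite X] [Finite M] [Fintype (Submodule R X)] :
    Nat.card (X →ₗ[R] M) =
      ∑ K : Submodule R X, Nat.card {g : (X ⧸ K) →ₗ[R] M // Function.Injective g} := by
  have (K : Submodule R X) : Finite ((X ⧸ K) →ₗ[R] M) :=
    have : Finite (X ⧸ K) := Finite.of_surjective _ K.mkQ_surjective
    DFunLike.finite _
  rw [← Nat.card_sigma]
  exact Nat.card_congr ((Equiv.sigmaFiberEquiv LinearMap.ker).symm.trans
    (Equiv.sigmaCongrRight fun K => LinearMap.kerEqEquivInjective K))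

/-- If all finite modules `X` have equally many linear maps to `M` and to `N`, then they have
equally many injective ones. -/
theorem LinearMap.natCard_injective_eq {M N : Type*} [AddCommGroup M] [Module R M] [Finite M]
    [AddCommGroup N] [Module R N] [Finite N]
    (h : ∀ (X : Type w) [AddCommGroup X] [Module R X] [Finite X],
      Nat.card (X →ₗ[R] M) = Nat.card (X →ₗ[R] N))
    (X : Type w) [AddCommGroup X] [Module R X] [Finite X] :
    Nat.card {f : X →ₗ[R] M // Function.Injective f} =
      Nat.card {f : X →ₗ[R] N // Function.Injective f} := by
  induction hn : Nat.card X using Nat.strong_induction_on generalizing X with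
  | _ n ih =>
    subst hn
    classical
    have : Fintype (Submodule R X) := Fintype.ofFinite _
    have key := h X
    rw [natCard_eq_sum_injective, natCard_eq_sum_injective,
      ← Finset.add_sum_erase _ _ (Finset.mem_univ ⊥),
      ← Finset.add_sum_erase _ _ (Finset.mem_univ ⊥)] at key
    have hsum : ∑ K ∈ Finset.univ.erase (⊥ : Submodule R X),
          Nat.card {g : (X ⧸ K) →ₗ[R] M // Function.Injective g} =
        ∑ K ∈ Finset.univ.erase (⊥ : Submodule R X),
          Nat.card {g : (X ⧸ K) →ₗ[R] N // Function.Injective g} := by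
      refine Finset.sum_congr rfl fun K hK => ?_
      have : Finite (X ⧸ K) := Finite.of_surjective _ K.mkQ_surjective
      refine ih _ ?_ (X ⧸ K) rfl
      have hK' : K ≠ ⊥ := (Finset.mem_erase.1 hK).1
      have : Nontrivial K := Submodule.nontrivial_iff_ne_bot.2 hK'
      rw [Submodule.card_eq_card_quotient_mul_card K]
      exact lt_mul_of_one_lt_left Nat.card_pos Finite.one_lt_card
    rw [hsum] at key
    have key' := Nat.add_right_cancel key
    rwa [← Nat.card_congr (LinearMap.kerEqEquivInjective ⊥),
      ← Nat.card_congr (LinearMap.kerEqEquivInjective ⊥),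
      Nat.card_congr (Equiv.subtypeEquivRight fun _ => LinearMap.ker_eq_bot),
      Nat.card_congr (Equiv.subtypeEquivRight fun _ => LinearMap.ker_eq_bot)] at key'

theorem LinearMap.exists_injective_of_natCard_eq {M : Type w} {N : Type*} [AddCommGroup M]
    [Module R M] [Finite M] [AddCommGroup N] [Module R N] [Finite N]
    (h : ∀ (X : Type w) [AddCommGroup X] [Module R X] [Finite X],
      Nat.card (X →ₗ[R] M) = Nat.card (X →ₗ[R] N)) :
    ∃ f : M →ₗ[R] N, Function.Injective f := by
  have : Finite (M →ₗ[R] M) := DFunLike.finite _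
  have : Nonempty {f : M →ₗ[R] M // Function.Injective f} := ⟨LinearMap.id, fun _ _ h => h⟩
  have hpos : 0 < Nat.card {f : M →ₗ[R] M // Function.Injective f} := Nat.card_pos
  rw [LinearMap.natCard_injective_eq h M] at hpos
  obtain ⟨f, hf⟩ := (Nat.card_pos_iff.1 hpos).1
  exact ⟨f, hf⟩

end HomCounting

section BaseChange

variable {k A X M N : Type*} [Field k] [Ring A] [Algebra k A]
  [AddCommGroup X] [Module k X] [Module A X] [IsScalarTower k A X]
  [AddCommGroup M] [Module k M] [Module A M] [IsScalarTower k A M]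
  [AddCommGroup N] [Module k N] [Module A N] [IsScalarTower k A N]
  (k' : Type*) [Field k'] [Algebra k k']

variable (k A X M) in
/-- The map sending `c ⊗ f` to `x ↦ c ⊗ f x`. -/
noncomputable def tensorHomToHomTensor : k' ⊗[k] (X →ₗ[A] M) →ₗ[k'] X →ₗ[k] k' ⊗[k] M :=
  LinearMap.liftBaseChange k'
    { toFun f := TensorProduct.mk k k' M 1 ∘ₗ f.restrictScalars k
      map_add' f g := by ext; simp [tmul_add]
      map_smul' c f := by ext; simp }

@[simp]
theorem tensorHomToHomTensor_tmul_apply (c : k') (f : X →ₗ[A] M) (x : X) :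
    tensorHomToHomTensor k A X M k' (c ⊗ₜ f) x = c ⊗ₜ f x := by
  simp [tensorHomToHomTensor, smul_tmul']

theorem tensorHomToHomTensor_injective :
    Function.Injective (tensorHomToHomTensor k A X M k') := by
  classical
  rw [injective_iff_map_eq_zero]
  intro t ht
  let B := Basis.ofVectorSpace k k'
  obtain ⟨b, rfl⟩ := (TensorProduct.equivFinsuppOfBasisLeft B).symm.surjective t
  suffices b = 0 by simp [this]
  ext i x
  have hx := congrArg (fun F => TensorProduct.equivFinsuppOfBasisLeft B (F x) i) ht
  by_contra hne
  refine hne ((?_ : b i ≠ 0 → b i x = 0) fun h => hne (by simp [h]))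
  simpa [Finsupp.sum, map_sum, LinearMap.sum_apply, Finsupp.single_apply,
    Finsupp.finsetSum_apply] using hx

theorem mem_range_tensorHomToHomTensor [Module.Finite k X] (F : X →ₗ[k] k' ⊗[k] M) :
    F ∈ LinearMap.range (tensorHomToHomTensor k A X M k') ↔
      ∀ (a : A) (x : X), F (a • x) = (Algebra.lsmul k k M a).baseChange k' (F x) := by
  classical
  constructor
  · rintro ⟨t, rfl⟩ a x
    induction t with
    | zero => simp
    | tmul c f => simp
    | add s t hs ht => simp_all
  · intro hF
    let B := Basis.ofVectorSpace k k'
    obtain ⟨t, rfl⟩ := (lTensorHomEquivHomLTensor k X k' M).surjective F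
    obtain ⟨b, rfl⟩ := (TensorProduct.equivFinsuppOfBasisLeft B).symm.surjective t
    have hcoord (i) (y : k' ⊗[k] M) (a : A) : TensorProduct.equivFinsuppOfBasisLeft B
        ((Algebra.lsmul k k M a).baseChange k' y) i =
          a • TensorProduct.equivFinsuppOfBasisLeft B y i := by
      induction y with
      | zero => simp
      | tmul c m => simpa using smul_comm (B.repr c i) a m
      | add s t hs ht => simp_all
    have hb (i) (x : X) : TensorProduct.equivFinsuppOfBasisLeft B
        (lTensorHomEquivHomLTensor k X k' M
          ((TensorProduct.equivFinsuppOfBasisLeft B).symm b) x) i = b i x := by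
      simp [Finsupp.sum, map_sum, LinearMap.sum_apply, Finsupp.single_apply,
        Finsupp.finsetSum_apply]
      exact fun h => by simp [h]
    have hlin (i) (a : A) (x : X) : b i (a • x) = a • b i x := by
      rw [← hb, hF, hcoord, hb]
    refine ⟨∑ i ∈ b.support, B i ⊗ₜ { b i with map_smul' := hlin i }, ?_⟩
    ext x
    simp [Finsupp.sum, map_sum, LinearMap.sum_apply]

variable {k'}

theorem exists_tensorHom_of_baseChange_equiv [Module.Finite k X]
    (e : k' ⊗[k] M →ₗ[k'] k' ⊗[k] N)
    (he : ∀ (a : A) (y : k' ⊗[k] M), e ((Algebra.lsmul k k M a).baseChange k' y) =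
      (Algebra.lsmul k k N a).baseChange k' (e y)) (t : k' ⊗[k] (X →ₗ[A] M)) :
    ∃ s : k' ⊗[k] (X →ₗ[A] N), tensorHomToHomTensor k A X N k' s =
      e.restrictScalars k ∘ₗ tensorHomToHomTensor k A X M k' t := by
  refine (mem_range_tensorHomToHomTensor k' _).2 fun a x => ?_
  have := (mem_range_tensorHomToHomTensor k' _).1 ⟨t, rfl⟩ a x
  simp [this, he]

theorem finrank_hom_le_of_baseChange_equiv [Module.Finite k X] [Module.Finite k N]
    (e : k' ⊗[k] M ≃ₗ[k'] k' ⊗[k] N)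
    (he : ∀ (a : A) (y : k' ⊗[k] M), e ((Algebra.lsmul k k M a).baseChange k' y) =
      (Algebra.lsmul k k N a).baseChange k' (e y)) :
    finrank k (X →ₗ[A] M) ≤ finrank k (X →ₗ[A] N) := by
  have : Module.Finite k (X →ₗ[A] N) :=
    Module.Finite.of_injective (LinearMap.restrictScalarsₗ k A X N k)
      (LinearMap.restrictScalars_injective k)
  choose φ hφ using exists_tensorHom_of_baseChange_equiv (X := X) e.toLinearMap he
  have hinj := tensorHomToHomTensor_injective (k := k) (A := A) (X := X) (M := N) k'
  let ψ : k' ⊗[k] (X →ₗ[A] M) →ₗ[k'] k' ⊗[k] (X →ₗ[A] N) :=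
    { toFun := φ
      map_add' s t := hinj (by ext; simp [hφ])
      map_smul' c t := hinj (by ext; simp [hφ]) }
  have hψ : Function.Injective ψ := fun s t hst => by
    have h := congrArg (tensorHomToHomTensor k A X N k') hst
    change tensorHomToHomTensor k A X N k' (φ s) = tensorHomToHomTensor k A X N k' (φ t) at h
    rw [hφ, hφ] at h
    refine tensorHomToHomTensor_injective k' (LinearMap.ext fun x => e.injective ?_)
    exact LinearMap.congr_fun h x
  simpa using LinearMap.finrank_le_finrank_of_injective hψ

theorem symm_commutes_lsmul_baseChange (e : k' ⊗[k] M ≃ₗ[k'] k' ⊗[k] N)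
    (he : ∀ (a : A) (y : k' ⊗[k] M), e ((Algebra.lsmul k k M a).baseChange k' y) =
      (Algebra.lsmul k k N a).baseChange k' (e y)) (a : A) (y : k' ⊗[k] N) :
    e.symm ((Algebra.lsmul k k N a).baseChange k' y) =
      (Algebra.lsmul k k M a).baseChange k' (e.symm y) := by
  rw [LinearEquiv.symm_apply_eq, he, LinearEquiv.apply_symm_apply]

theorem exists_injective_of_baseChange_equiv_of_finite [Finite k] [Module.Finite k M]
    [Module.Finite k N] (e : k' ⊗[k] M ≃ₗ[k'] k' ⊗[k] N)
    (he : ∀ (a : A) (y : k' ⊗[k] M), e ((Algebra.lsmul k k M a).baseChange k' y) =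
      (Algebra.lsmul k k N a).baseChange k' (e y)) :
    ∃ f : M →ₗ[A] N, Function.Injective f := by
  have : Finite M := Module.finite_of_finite k
  have : Finite N := Module.finite_of_finite k
  refine LinearMap.exists_injective_of_natCard_eq fun X _ _ _ => ?_
  let : Module k X := Module.compHom X (algebraMap k A)
  have : IsScalarTower k A X := IsScalarTower.of_algebraMap_smul fun _ _ => rfl
  have : Module.Finite k X := Module.Finite.of_finite
  have : Module.Finite k (X →ₗ[A] M) :=
    Module.Finite.of_injective (LinearMap.restrictScalarsₗ k A X M k)
      (LinearMap.restrictScalars_injective k)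
  have : Module.Finite k (X →ₗ[A] N) :=
    Module.Finite.of_injective (LinearMap.restrictScalarsₗ k A X N k)
      (LinearMap.restrictScalars_injective k)
  exact Nat.card_congr (LinearEquiv.ofFinrankEq _ _
    ((finrank_hom_le_of_baseChange_equiv e he).antisymm
      (finrank_hom_le_of_baseChange_equiv e.symm
        (symm_commutes_lsmul_baseChange e he)))).toEquiv

/-- If a linear combination of square matrices over an infinite field `k` with coefficients in an
extension field is invertible, then so is one with coefficients in `k`. -/
theorem Matrix.exists_det_sum_smul_ne_zero [Infinite k] {ι n : Type*} [Fintype ι] [Fintype n]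
    [DecidableEq n] (S : ι → Matrix n n k) (c : ι → k')
    (h : (∑ i, c i • (S i).map (algebraMap k k')).det ≠ 0) :
    ∃ r : ι → k, (∑ i, r i • S i).det ≠ 0 := by
  let P : Matrix n n (MvPolynomial ι k) := ∑ i, MvPolynomial.X (R := k) i • (S i).map MvPolynomial.C
  have hP : P.det ≠ 0 := fun h0 => h <| by
    have := congrArg (MvPolynomial.aeval c) h0
    rw [AlgHom.map_det, map_zero] at this
    rw [← this]
    congr 1
    ext a b
    simp [P, Matrix.sum_apply]
  by_contra! hr
  refine hP (MvPolynomial.funext fun r => ?_)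
  rw [RingHom.map_det, map_zero, ← hr r]
  congr 1
  ext a b
  simp [P, Matrix.sum_apply]

theorem exists_injective_of_baseChange_equiv_of_infinite [Infinite k] [Module.Finite k M]
    [Module.Finite k N] (e : k' ⊗[k] M ≃ₗ[k'] k' ⊗[k] N)
    (he : ∀ (a : A) (y : k' ⊗[k] M), e ((Algebra.lsmul k k M a).baseChange k' y) =
      (Algebra.lsmul k k N a).baseChange k' (e y)) :
    ∃ f : M →ₗ[A] N, Function.Injective f := by
  have hrank : finrank k N = finrank k M := by simpa using e.finrank_eq.symm
  let bM := finBasis k M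
  let bN := finBasisOfFinrankEq k N hrank
  obtain ⟨s, hs⟩ := exists_tensorHom_of_baseChange_equiv (X := M) e.toLinearMap he
    (1 ⊗ₜ LinearMap.id)
  obtain ⟨m, c, f, rfl⟩ := TensorProduct.exists_sum_tmul_eq s
  have hmat : LinearMap.toMatrix (bM.baseChange k') (bN.baseChange k') e.toLinearMap =
      ∑ i, c i • (LinearMap.toMatrix bM bN ((f i).restrictScalars k)).map (algebraMap k k') := by
    ext a b
    have hb : e (1 ⊗ₜ bM b) = ∑ i, c i ⊗ₜ f i (bM b) := by
      simpa [LinearMap.sum_apply] using (LinearMap.congr_fun hs (bM b)).symm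
    simp [LinearMap.toMatrix_apply, hb, Matrix.sum_apply,
      Finsupp.finsetSum_apply, Algebra.smul_def (A := k'), mul_comm]
  obtain ⟨r, hr⟩ := Matrix.exists_det_sum_smul_ne_zero
    (fun i => LinearMap.toMatrix bM bN ((f i).restrictScalars k)) c
    (hmat ▸ (e.isUnit_det (bM.baseChange k') (bN.baseChange k')).ne_zero)
  let g : M →ₗ[A] N := ∑ i, r i • f i
  have hg : LinearMap.toMatrix bM bN (g.restrictScalars k) =
      ∑ i, r i • LinearMap.toMatrix bM bN ((f i).restrictScalars k) := by
    ext a b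
    simp [g, LinearMap.toMatrix_apply, Matrix.sum_apply, LinearMap.sum_apply,
      Finsupp.finsetSum_apply]
  rw [← hg] at hr
  exact ⟨g, (LinearEquiv.ofIsUnitDet hr.isUnit).injective⟩

/-- The Noether–Deuring theorem for finite-dimensional modules over an algebra. -/
theorem nonempty_linearEquiv_of_baseChange_equiv [Module.Finite k M]
    [Module.Finite k N] (e : k' ⊗[k] M ≃ₗ[k'] k' ⊗[k] N)
    (he : ∀ (a : A) (y : k' ⊗[k] M), e ((Algebra.lsmul k k M a).baseChange k' y) =
      (Algebra.lsmul k k N a).baseChange k' (e y)) :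
    Nonempty (M ≃ₗ[A] N) := by
  have hrank : finrank k M = finrank k N := by simpa using e.finrank_eq
  obtain ⟨f, hf⟩ : ∃ f : M →ₗ[A] N, Function.Injective f := by
    cases finite_or_infinite k
    · exact exists_injective_of_baseChange_equiv_of_finite e he
    · exact exists_injective_of_baseChange_equiv_of_infinite e he
  exact ⟨LinearEquiv.ofBijective f ⟨hf, (LinearMap.injective_iff_surjective_of_finrank_eq_finrank
    (f := f.restrictScalars k) hrank).1 hf⟩⟩

end BaseChange

/-- Noether–Deuring: if `k ⊆ k'` is an algebraic field extension and `M`, `N`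
are finitely generated `kG`-modules whose base changes `k' ⊗_k M` and `k' ⊗_k N` are
isomorphic as `k'G`-modules, then `M ≅ N` as `kG`-modules. -/
theorem stmt_5 (k k' G : Type*) [Field k] [Field k'] [Algebra k k']
    [Algebra.IsAlgebraic k k'] [Group G] [Finite G]
    (M N : Type*) [AddCommGroup M] [Module k M] [Module.Finite k M]
    [AddCommGroup N] [Module k N] [Module.Finite k N]
    (ρ : Representation k G M) (σ : Representation k G N)
    (h : ∃ e : (k' ⊗[k] M) ≃ₗ[k'] (k' ⊗[k] N),
      ∀ (g : G) (x : k' ⊗[k] M), e (repBaseChange k' ρ g x) = repBaseChange k' σ g (e x)) :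
    ∃ e : M ≃ₗ[k] N, ∀ (g : G) (x : M), e (ρ g x) = σ g (e x) := by
  obtain ⟨e, he⟩ := h
  let e' : k' ⊗[k] ρ.asModule ≃ₗ[k'] k' ⊗[k] σ.asModule := e
  have he' (a : MonoidAlgebra k G) (y : k' ⊗[k] ρ.asModule) :
      e' ((Algebra.lsmul k k ρ.asModule a).baseChange k' y) =
        (Algebra.lsmul k k σ.asModule a).baseChange k' (e' y) := by
    induction a using MonoidAlgebra.induction_on with
    | of g =>
      have hρ : Algebra.lsmul k k ρ.asModule (MonoidAlgebra.of k G g) = ρ g :=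
        LinearMap.ext fun x => by
          simp [Representation.single_smul]; rfl
      have hσ : Algebra.lsmul k k σ.asModule (MonoidAlgebra.of k G g) = σ g :=
        LinearMap.ext fun x => by
          simp [Representation.single_smul]; rfl
      rw [hρ, hσ]
      exact he g y
    | add a b ha hb => simp [LinearMap.baseChange_add, ha, hb]
    | smul r a ha =>
      rw [map_smul, map_smul, LinearMap.baseChange_smul, LinearMap.baseChange_smul,
        LinearMap.smul_apply, LinearMap.smul_apply, ← ha]
      exact map_smul (e'.restrictScalars k) r _
  obtain ⟨f⟩ := nonempty_linearEquiv_of_baseChange_equiv e' he'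
  refine ⟨f.restrictScalars k, fun g x => ?_⟩
  have := f.map_smul (MonoidAlgebra.single g 1) (ρ.asModuleEquiv.symm x)
  rw [Representation.single_smul, Representation.single_smul, one_smul, one_smul] at this
  exact this
end

section
/- Let G be a finite group and let k ⊆ k' be an algebraic extension of fields. If M is a finitely generated kG-module having no nonzero projective direct summand, then the base change k' ⊗_k M has no nonzero projective direct summand as a k'G-module. -/
open TensorProduct

/-- A module has no nonzero projective direct summand if there is no direct sum
decomposition with a nonzero projective factor. -/
def HasNoNonzeroProjSummand (R V : Type*) [Ring R] [AddCommMonoid V] [Module R V] : Prop :=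
  ¬ ∃ (N N' : Submodule R V), IsCompl N N' ∧ N ≠ ⊥ ∧ Module.Projective R N

section Higman

open LinearMap

variable {k G : Type*} [Field k] [Group G] [Fintype G]

theorem LinearMap.sumOfConjugatesEquivariant_comp_comp
    {U V W X : Type*}
    [AddCommGroup U] [Module k U] [Module (MonoidAlgebra k G) U]
    [IsScalarTower k (MonoidAlgebra k G) U]
    [AddCommGroup V] [Module k V] [Module (MonoidAlgebra k G) V]
    [IsScalarTower k (MonoidAlgebra k G) V]
    [AddCommGroup W] [Module k W] [Module (MonoidAlgebra k G) W]
    [IsScalarTower k (MonoidAlgebra k G) W]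
    [AddCommGroup X] [Module k X] [Module (MonoidAlgebra k G) X]
    [IsScalarTower k (MonoidAlgebra k G) X]
    (a : W →ₗ[MonoidAlgebra k G] X) (φ : V →ₗ[k] W) (b : U →ₗ[MonoidAlgebra k G] V) :
    (a.restrictScalars k ∘ₗ φ ∘ₗ b.restrictScalars k).sumOfConjugatesEquivariant G =
      a ∘ₗ φ.sumOfConjugatesEquivariant G ∘ₗ b := by
  ext u
  simp [sumOfConjugatesEquivariant_apply, conjugate_apply]

theorem Finsupp.exists_sumOfConjugatesEquivariant_eq_id (ι : Type*) :
    ∃ φ : (ι →₀ MonoidAlgebra k G) →ₗ[k] (ι →₀ MonoidAlgebra k G),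
      φ.sumOfConjugatesEquivariant G = LinearMap.id := by
  classical
  let e : MonoidAlgebra k G →ₗ[k] MonoidAlgebra k G :=
    { toFun := fun x => MonoidAlgebra.single 1 (x.coeff 1)
      map_add' := fun x y => by simp
      map_smul' := fun c x => by simp }
  refine ⟨Finsupp.mapRange.linearMap e, LinearMap.ext fun f => Finsupp.ext fun n => ?_⟩
  rw [sumOfConjugatesEquivariant_apply]
  simp only [conjugate_apply, Finsupp.finsetSum_apply, Finsupp.smul_apply,
    Finsupp.mapRange.linearMap_apply, Finsupp.mapRange_apply, LinearMap.id_apply, smul_eq_mul]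
  have : ∀ g : G, MonoidAlgebra.single g⁻¹ (1 : k) * e (MonoidAlgebra.single g 1 * f n) =
      MonoidAlgebra.single g⁻¹ ((f n).coeff g⁻¹) := fun g => by
    change _ * MonoidAlgebra.single 1 (MonoidAlgebra.coeff _ 1) = _
    simp [MonoidAlgebra.single_mul_single, MonoidAlgebra.coeff_single_mul_apply]
  simp only [this]
  refine (Equiv.sum_comp (Equiv.inv G)
    fun g => MonoidAlgebra.single g ((f n).coeff g)).trans ?_
  ext g
  simp [MonoidAlgebra.coeff_sum]

/-- Higman's criterion. -/
theorem Module.Projective.iff_exists_sumOfConjugatesEquivariant_eq_id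
    {N : Type*} [AddCommGroup N] [Module k N] [Module (MonoidAlgebra k G) N]
    [IsScalarTower k (MonoidAlgebra k G) N] :
    Module.Projective (MonoidAlgebra k G) N ↔
      ∃ φ : N →ₗ[k] N, φ.sumOfConjugatesEquivariant G = LinearMap.id := by
  constructor
  · intro hN
    obtain ⟨s, hs⟩ := Module.projective_def'.1 hN
    obtain ⟨φ, hφ⟩ := Finsupp.exists_sumOfConjugatesEquivariant_eq_id (k := k) (G := G) N
    refine ⟨_, (sumOfConjugatesEquivariant_comp_comp
      (Finsupp.linearCombination (MonoidAlgebra k G) id) φ s).trans ?_⟩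
    rw [hφ, LinearMap.id_comp, hs]
  · rintro ⟨φ, hφ⟩
    refine .of_lifting_property'' fun f hf => ?_
    obtain ⟨σ, hσ⟩ := (f.restrictScalars k).exists_rightInverse_of_surjective
      (LinearMap.range_eq_top.2 hf)
    refine ⟨(σ ∘ₗ φ).sumOfConjugatesEquivariant G, ?_⟩
    have := sumOfConjugatesEquivariant_comp_comp f (σ ∘ₗ φ)
      (LinearMap.id : N →ₗ[MonoidAlgebra k G] N)
    rw [LinearMap.comp_id] at this
    have hφ' : f.restrictScalars k ∘ₗ (σ ∘ₗ φ) = φ := by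
      rw [← LinearMap.comp_assoc, hσ, LinearMap.id_comp]
    rw [← this, restrictScalars_id, LinearMap.comp_id, hφ', hφ]

end Higman

section ProjectiveEndomorphisms

open LinearMap

variable (k G V : Type*) [Field k] [Group G] [Fintype G] [AddCommGroup V] [Module k V]
  [Module (MonoidAlgebra k G) V] [IsScalarTower k (MonoidAlgebra k G) V]

/-- The endomorphisms of a `kG`-module that are sums of conjugates of a `k`-linear endomorphism
(equivalently, that factor through a projective module), as a left ideal of the endomorphism
ring. -/
def sumOfConjugatesIdeal : Ideal (Module.End (MonoidAlgebra k G) V) where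
  carrier := Set.range fun φ : V →ₗ[k] V => φ.sumOfConjugatesEquivariant G
  zero_mem' := ⟨0, by ext; simp [sumOfConjugatesEquivariant_apply, conjugate_apply]⟩
  add_mem' := by
    rintro _ _ ⟨φ, rfl⟩ ⟨ψ, rfl⟩
    exact ⟨φ + ψ, by
      ext
      simp [sumOfConjugatesEquivariant_apply, conjugate_apply, Finset.sum_add_distrib]⟩
  smul_mem' := by
    rintro a _ ⟨φ, rfl⟩
    exact ⟨_, sumOfConjugatesEquivariant_comp_comp a φ LinearMap.id⟩

variable {k G V}

theorem mem_sumOfConjugatesIdeal {x : Module.End (MonoidAlgebra k G) V} :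
    x ∈ sumOfConjugatesIdeal k G V ↔
      ∃ φ : V →ₗ[k] V, φ.sumOfConjugatesEquivariant G = x := Iff.rfl

variable [Module.Finite k V]

theorem isNilpotent_of_mem_sumOfConjugatesIdeal
    (h : HasNoNonzeroProjSummand (MonoidAlgebra k G) V)
    {x : Module.End (MonoidAlgebra k G) V} (hx : x ∈ sumOfConjugatesIdeal k G V) :
    IsNilpotent x := by
  have : IsArtinian (MonoidAlgebra k G) V := isArtinian_of_tower k inferInstance
  have : IsNoetherian (MonoidAlgebra k G) V := isNoetherian_of_tower k inferInstance
  obtain ⟨n, hn, hc⟩ := ((Filter.eventually_ge_atTop 1).and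
    x.eventually_isCompl_ker_pow_range_pow).exists
  have hy : x ^ n ∈ sumOfConjugatesIdeal k G V := Ideal.pow_mem_of_mem _ hx n hn
  refine ⟨n, ?_⟩
  generalize x ^ n = y at hc hy
  obtain ⟨φ, hφ⟩ := mem_sumOfConjugatesIdeal.1 hy
  by_contra hne
  refine h ⟨range y, ker y, hc.symm, fun h0 => hne (range_eq_bot.1 h0),
    (Module.Projective.iff_exists_sumOfConjugatesEquivariant_eq_id (k := k)).2 ?_⟩
  have hinj : Function.Injective (y.rangeRestrict ∘ₗ (range y).subtype) := by
    rw [← ker_eq_bot, eq_bot_iff]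
    intro v hv
    have hv' : (v : V) ∈ ker y := by simpa [Subtype.ext_iff] using hv
    exact Subtype.ext (Submodule.disjoint_def.1 hc.disjoint v hv' v.2)
  let u := LinearEquiv.ofBijective _ (IsArtinian.bijective_of_injective_endomorphism _ hinj)
  refine ⟨_, (sumOfConjugatesEquivariant_comp_comp
    (u.symm.toLinearMap ∘ₗ (range y).projectionOnto (ker y) hc.symm) φ
    (range y).subtype).trans ?_⟩
  rw [hφ]
  ext v : 1
  have : (range y).projectionOnto (ker y) hc.symm (y v) = u v :=
    Submodule.projectionOnto_apply_left hc.symm (u v)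
  simp [this]

theorem isNilpotent_sumOfConjugatesIdeal
    (h : HasNoNonzeroProjSummand (MonoidAlgebra k G) V) :
    IsNilpotent (sumOfConjugatesIdeal k G V) := by
  have : IsArtinianRing (Module.End (MonoidAlgebra k G) V) := by
    have : Module.Finite k (Module.End (MonoidAlgebra k G) V) :=
      .of_injective (restrictScalarsₗ k (MonoidAlgebra k G) V V k)
        (restrictScalars_injective k)
    exact isArtinian_of_tower k inferInstance
  have hle : sumOfConjugatesIdeal k G V ≤ Ideal.jacobson ⊥ := by
    intro x hx
    rw [Ideal.mem_jacobson_iff]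
    intro y
    have hu := (isNilpotent_of_mem_sumOfConjugatesIdeal h (Ideal.mul_mem_left _ y hx)).isUnit_one_add
    obtain ⟨z, hz⟩ := hu.exists_left_inv
    refine ⟨z, ?_⟩
    rw [Submodule.mem_bot, ← hz]
    noncomm_ring
  obtain ⟨n, hn⟩ := IsArtinianRing.isNilpotent_jacobson_bot
    (R := Module.End (MonoidAlgebra k G) V)
  exact ⟨n, le_bot_iff.1 ((Ideal.pow_right_mono hle n).trans hn.le)⟩

end ProjectiveEndomorphisms

open scoped Pointwise in
theorem Ideal.set_pow_succ_subset {R : Type*} [Ring R] (I : Ideal R) (n : ℕ) :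
    (I : Set R) ^ (n + 1) ⊆ (I ^ (n + 1) : Ideal R) := by
  induction n with
  | zero => rw [zero_add, pow_one, Submodule.pow_one]
  | succ n ih =>
    rw [pow_succ, pow_succ]
    rintro _ ⟨a, ha, b, hb, rfl⟩
    exact Ideal.mul_mem_mul (ih ha) hb

section BaseChange

open LinearMap

variable {k G V : Type*} (k' : Type*) [Field k] [Field k'] [Algebra k k'] [Group G] [Fintype G]
  [AddCommGroup V] [Module k V] [Module (MonoidAlgebra k G) V]
  [IsScalarTower k (MonoidAlgebra k G) V]

variable (k G V) in
/-- Base change of `kG`-linear endomorphisms, as a monoid homomorphism into the `k'`-linear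
endomorphisms of the base change. -/
noncomputable def equivariantEndBaseChange :
    Module.End (MonoidAlgebra k G) V →* Module.End k' (k' ⊗[k] V) where
  toFun x := LinearMap.baseChange k' (x.restrictScalars k)
  map_one' := LinearMap.baseChange_one k V
  map_mul' x y := LinearMap.baseChange_mul (x.restrictScalars k) (y.restrictScalars k)

variable {k'} [Module (MonoidAlgebra k' G) (k' ⊗[k] V)]
  [IsScalarTower k' (MonoidAlgebra k' G) (k' ⊗[k] V)]

theorem sumOfConjugates_baseChange
    (hG : ∀ (g : G) (c : k') (v : V),
      MonoidAlgebra.single g (1 : k') • c ⊗ₜ[k] v = c ⊗ₜ (MonoidAlgebra.single g (1 : k) • v))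
    (φ : V →ₗ[k] V) :
    (φ.baseChange k').sumOfConjugates G =
      equivariantEndBaseChange k G V k' (φ.sumOfConjugatesEquivariant G) := by
  ext v
  change _ = (1 : k') ⊗ₜ[k] φ.sumOfConjugatesEquivariant G v
  simp [sumOfConjugates_apply, sumOfConjugatesEquivariant_apply, conjugate_apply, hG,
    TensorProduct.tmul_sum]

theorem sumOfConjugates_mem_span [Module.Finite k V]
    (hG : ∀ (g : G) (c : k') (v : V),
      MonoidAlgebra.single g (1 : k') • c ⊗ₜ[k] v = c ⊗ₜ (MonoidAlgebra.single g (1 : k) • v))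
    (ψ : k' ⊗[k] V →ₗ[k'] k' ⊗[k] V) :
    ψ.sumOfConjugates G ∈ Submodule.span k'
      (equivariantEndBaseChange k G V k' '' (sumOfConjugatesIdeal k G V)) := by
  have : Module.FinitePresentation k V := Module.finitePresentation_of_finite k V
  have hb := Module.FinitePresentation.isBaseChange_map k V V k'
  induction ψ using hb.inductionOn with
  | zero =>
    convert Submodule.zero_mem _
    ext
    simp [sumOfConjugates_apply, conjugate_apply]
  | tmul φ =>
    rw [baseChangeHom_apply, sumOfConjugates_baseChange hG]
    exact Submodule.subset_span ⟨_, ⟨φ, rfl⟩, rfl⟩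
  | smul c ψ hψ =>
    convert Submodule.smul_mem _ c hψ
    ext
    simp [sumOfConjugates_apply, conjugate_apply, Finset.smul_sum, smul_comm c]
  | add ψ₁ ψ₂ h₁ h₂ =>
    convert Submodule.add_mem _ h₁ h₂
    ext
    simp [sumOfConjugates_apply, conjugate_apply, Finset.sum_add_distrib]

open scoped Pointwise in
theorem HasNoNonzeroProjSummand.baseChange [Module.Finite k V]
    (hG : ∀ (g : G) (c : k') (v : V),
      MonoidAlgebra.single g (1 : k') • c ⊗ₜ[k] v = c ⊗ₜ (MonoidAlgebra.single g (1 : k) • v))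
    (h : HasNoNonzeroProjSummand (MonoidAlgebra k G) V) :
    HasNoNonzeroProjSummand (MonoidAlgebra k' G) (k' ⊗[k] V) := by
  obtain ⟨n, hn⟩ := isNilpotent_sumOfConjugatesIdeal h
  rintro ⟨N, N', hc, hN, hP⟩
  refine hN ?_
  obtain ⟨φ, hφ⟩ :=
    (Module.Projective.iff_exists_sumOfConjugatesEquivariant_eq_id
      (k := k') (G := G) (N := N)).1 hP
  have he := LinearMap.sumOfConjugatesEquivariant_comp_comp
    (U := k' ⊗[k] V) (V := N) (W := N) (X := k' ⊗[k] V) (k := k') (G := G)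
    N.subtype φ (N.projectionOnto N' hc)
  rw [hφ, LinearMap.id_comp] at he
  have hmem := sumOfConjugates_mem_span hG
    (N.subtype.restrictScalars k' ∘ₗ φ ∘ₗ (N.projectionOnto N' hc).restrictScalars k')
  set e : Module.End k' (k' ⊗[k] V) := LinearMap.sumOfConjugates G
    (N.subtype.restrictScalars k' ∘ₗ φ ∘ₗ (N.projectionOnto N' hc).restrictScalars k')
  have happ : ∀ v : k' ⊗[k] V, e v = N.projectionOnto N' hc v :=
    fun v => LinearMap.congr_fun he v
  have hfix : ∀ v ∈ N, ∀ m : ℕ, (e ^ m) v = v := by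
    intro v hv m
    have hev : e v = v := by
      rw [happ]
      exact congrArg Subtype.val (Submodule.projectionOnto_apply_left hc ⟨v, hv⟩)
    induction m with
    | zero => rfl
    | succ m ih => rw [pow_succ, Module.End.mul_apply, hev, ih]
  have hpow := Submodule.pow_mem_pow _ hmem (n + 1)
  rw [Submodule.span_pow, ← Set.image_pow] at hpow
  have hzero : e ^ (n + 1) = 0 := by
    refine (Submodule.mem_bot k').1 (Submodule.span_le.2 ?_ hpow)
    rintro _ ⟨x, hx, rfl⟩
    have hx' := Ideal.set_pow_succ_subset _ n hx
    rw [Submodule.pow_succ, hn, zero_mul] at hx'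
    rw [(Submodule.mem_bot _).1 hx']
    exact LinearMap.baseChange_zero
  rw [eq_bot_iff]
  intro v hv
  rw [Submodule.mem_bot, ← hfix v hv (n + 1), hzero]
  rfl

end BaseChange

/-- Let `k ⊆ k'` be an algebraic extension of fields and `G` a finite group.
If a finitely generated `kG`-module `M` has no nonzero projective direct summand, then
`k' ⊗_k M` has no nonzero projective direct summand as a `k'G`-module. -/
theorem stmt_6 (k k' G : Type*) [Field k] [Field k'] [Algebra k k']
    [Algebra.IsAlgebraic k k'] [Group G] [Finite G]
    (M : Type*) [AddCommGroup M] [Module k M] [Module.Finite k M]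
    (ρ : Representation k G M)
    (h : HasNoNonzeroProjSummand (MonoidAlgebra k G) ρ.asModule) :
    HasNoNonzeroProjSummand (MonoidAlgebra k' G) (repBaseChange k' ρ).asModule := by
  have := Fintype.ofFinite G
  let : Module (MonoidAlgebra k' G) (k' ⊗[k] ρ.asModule) :=
    Representation.instModuleMonoidAlgebraAsModule (repBaseChange k' ρ)
  have : IsScalarTower k' (MonoidAlgebra k' G) (k' ⊗[k] ρ.asModule) :=
    Representation.instIsScalarTowerMonoidAlgebraAsModule (repBaseChange k' ρ)
  have key : HasNoNonzeroProjSummand (MonoidAlgebra k' G) (k' ⊗[k] ρ.asModule) :=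
    HasNoNonzeroProjSummand.baseChange (k := k) (G := G) (V := ρ.asModule) (fun g c v => by
      rw [Representation.single_smul, one_smul]
      refine (Representation.single_smul (repBaseChange k' ρ) 1 g (c ⊗ₜ[k] v)).trans ?_
      rw [one_smul]
      rfl) h
  exact key
end

section
/- Let G be a finite group, let k ⊆ k' be an algebraic extension of fields, and let D be a finitely generated kG-module. Then the largest integer r such that the free module (kG)^r is isomorphic to a direct summand of D equals the largest integer r' such that (k'G)^{r'} is isomorphic to a direct summand of k' ⊗_k D. Consequently, the codimension c(k,D) := dim_k D − (#G)·r of a maximal free kG-summand of D satisfies c(k', k' ⊗_k D) = c(k, D). -/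
open TensorProduct

/-- The set of ranks `r` such that the free module `R^r` is isomorphic
to a direct summand of `V`. -/
def FreeSummandRanks (R V : Type*) [Ring R] [AddCommMonoid V] [Module R V] : Set ℕ :=
  {r : ℕ | ∃ (N N' : Submodule R V), IsCompl N N' ∧ Nonempty (N ≃ₗ[R] (Fin r → R))}

open Module in
/-- The rank of a linear map between vector spaces is invariant under field extension. -/
theorem finrank_range_baseChange {k V W : Type*} (k' : Type*) [Field k] [Field k'] [Algebra k k']
    [AddCommGroup V] [Module k V] [AddCommGroup W] [Module k W] (f : V →ₗ[k] W) :
    finrank k' (LinearMap.range (f.baseChange k')) = finrank k (LinearMap.range f) := by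
  have hfac : f.baseChange k' =
      (LinearMap.range f).subtype.baseChange k' ∘ₗ f.rangeRestrict.baseChange k' := by
    rw [← LinearMap.baseChange_comp]
    rfl
  have hsurj : Function.Surjective (f.rangeRestrict.baseChange k') :=
    LinearMap.lTensor_surjective k' f.surjective_rangeRestrict
  have hinj : Function.Injective ((LinearMap.range f).subtype.baseChange k') :=
    Module.Flat.lTensor_preserves_injective_linearMap (M := k') _ (Submodule.injective_subtype _)
  rw [hfac, LinearMap.range_comp, LinearMap.range_eq_top.2 hsurj, Submodule.map_top,
    LinearMap.finrank_range_of_inj hinj, Module.finrank_baseChange]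

open Module in
theorem finrank_range_prodMap {k V V' W W' : Type*} [Field k]
    [AddCommGroup V] [Module k V] [AddCommGroup V'] [Module k V']
    [AddCommGroup W] [Module k W] [AddCommGroup W'] [Module k W']
    [Module.Finite k W] [Module.Finite k W'] (f : V →ₗ[k] W) (g : V' →ₗ[k] W') :
    finrank k (LinearMap.range (f.prodMap g)) =
      finrank k (LinearMap.range f) + finrank k (LinearMap.range g) := by
  have h : LinearMap.range (f.prodMap g) = LinearMap.range
      ((LinearMap.range f).subtype.prodMap (LinearMap.range g).subtype) := by
    simp [LinearMap.range_prodMap]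
  rw [h, LinearMap.finrank_range_of_inj, Module.finrank_prod]
  exact (Submodule.injective_subtype _).prodMap (Submodule.injective_subtype _)

/-- An element of `k' ⊗[k] V` vanishes once all functionals on `k'` send it to zero in `V`. -/
theorem TensorProduct.eq_zero_of_forall_rTensor_eq_zero {k k' V : Type*} [Field k]
    [AddCommGroup k'] [Module k k'] [AddCommGroup V] [Module k V] (y : k' ⊗[k] V)
    (h : ∀ φ : k' →ₗ[k] k, TensorProduct.lid k V (φ.rTensor V y) = 0) : y = 0 := by
  classical
  apply (TensorProduct.equivFinsuppOfBasisLeft (N := V) (Module.Basis.ofVectorSpace k k')).injective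
  ext i
  rw [TensorProduct.equivFinsuppOfBasisLeft_apply, h, map_zero, Finsupp.zero_apply]

section SemisimpleModules

open Module

/-- The rank over `k` of the action of an element of a `k`-algebra on a module. -/
noncomputable def actionRank (k : Type*) {A : Type*} (M : Type*) [Field k] [Ring A] [Algebra k A]
    [AddCommGroup M] [Module k M] [Module A M] [IsScalarTower k A M] (a : A) : ℕ :=
  finrank k (LinearMap.range (Algebra.lsmul k k M a))

variable {k A : Type*} [Field k] [Ring A] [Algebra k A]
  {M N : Type*} [AddCommGroup M] [Module k M] [Module A M] [IsScalarTower k A M]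
  [AddCommGroup N] [Module k N] [Module A N] [IsScalarTower k A N]

theorem actionRank_congr (e : M ≃ₗ[A] N) (a : A) : actionRank k M a = actionRank k N a := by
  let e' : M ≃ₗ[k] N := e.restrictScalars k
  have h : LinearMap.range (Algebra.lsmul k k N a) =
      (LinearMap.range (Algebra.lsmul k k M a)).map (e' : M →ₗ[k] N) := by
    rw [← LinearMap.range_comp]
    have : (e' : M →ₗ[k] N) ∘ₗ Algebra.lsmul k k M a = Algebra.lsmul k k N a ∘ₗ e' := by
      ext x
      exact e.map_smul a x
    rw [this, LinearMap.range_comp, LinearEquiv.range, Submodule.map_top]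
  rw [actionRank, actionRank, h, LinearEquiv.finrank_map_eq]

theorem actionRank_eq_zero_iff [Module.Finite k M] (a : A) :
    actionRank k M a = 0 ↔ ∀ m : M, a • m = 0 := by
  rw [actionRank, Submodule.finrank_eq_zero, LinearMap.range_eq_bot, LinearMap.ext_iff]
  rfl

theorem actionRank_prod [Module.Finite k M] [Module.Finite k N] (a : A) :
    actionRank k (M × N) a = actionRank k M a + actionRank k N a := by
  have h : Algebra.lsmul k k (M × N) a =
      (Algebra.lsmul k k M a).prodMap (Algebra.lsmul k k N a) := LinearMap.ext fun _ => rfl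
  rw [actionRank, h, finrank_range_prodMap]
  rfl

theorem actionRank_of_isCompl [Module.Finite k M] {p q : Submodule A M} (h : IsCompl p q) (a : A) :
    actionRank k M a = actionRank k p a + actionRank k q a := by
  have : Module.Finite k p := inferInstanceAs (Module.Finite k (p.restrictScalars k))
  have : Module.Finite k q := inferInstanceAs (Module.Finite k (q.restrictScalars k))
  rw [← actionRank_prod, actionRank_congr (Submodule.prodEquivOfIsCompl p q h)]

variable (k) in
/-- A simple module killed by the annihilator of a finite-dimensional semisimple module `M`
embeds into `M`. -/
theorem IsSemisimpleModule.exists_linearEquiv_submodule_of_smul_eq_zero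
    [Module.Finite k M] [IsSemisimpleModule A M]
    {T : Type*} [AddCommGroup T] [Module A T] [IsSimpleModule A T]
    (h : ∀ a : A, (∀ m : M, a • m = 0) → ∀ t : T, a • t = 0) :
    ∃ S : Submodule A M, Nonempty (T ≃ₗ[A] S) := by
  have := IsSimpleModule.nontrivial A T
  obtain ⟨t, ht⟩ := exists_ne (0 : T)
  let b := Module.finBasis k M
  let F : A →ₗ[A] (Fin (finrank k M) → M) :=
    LinearMap.pi fun i => LinearMap.toSpanSingleton A M (b i)
  have hker : LinearMap.ker F ≤ LinearMap.ker (LinearMap.toSpanSingleton A T t) := by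
    intro a ha
    refine h a (fun m => ?_) t
    have : Algebra.lsmul k k M a = 0 := b.ext fun i => congrFun ha i
    exact LinearMap.congr_fun this m
  obtain ⟨g, hg⟩ := IsSemisimpleModule.extension_property ((LinearMap.ker F).liftQ F le_rfl)
    (LinearMap.ker_eq_bot.1 (Submodule.ker_liftQ_eq_bot _ _ _ le_rfl))
    ((LinearMap.ker F).liftQ (LinearMap.toSpanSingleton A T t) hker)
  have hg1 : g (F 1) = t := by
    simpa using LinearMap.congr_fun hg ((LinearMap.ker F).mkQ 1)
  obtain ⟨i, hi⟩ : ∃ i, g ∘ₗ LinearMap.single A (fun _ => M) i ≠ 0 := by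
    by_contra! hzero
    have : g = 0 := LinearMap.pi_ext' fun i => by rw [hzero i, LinearMap.zero_comp]
    exact ht (by rw [← hg1, this, LinearMap.zero_apply])
  exact LinearMap.linearEquiv_of_ne_zero hi

/-- A finite-dimensional semisimple module on which every algebra element has rank at most its
rank on the finite-dimensional semisimple module `M` is a quotient of `M`. -/
theorem IsSemisimpleModule.exists_surjective_of_actionRank_le
    [Module.Finite k M] [Module.Finite k N] [IsSemisimpleModule A M] [IsSemisimpleModule A N]
    (h : ∀ a : A, actionRank k N a ≤ actionRank k M a) :
    ∃ f : M →ₗ[A] N, Function.Surjective f := by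
  induction hd : finrank k N using Nat.strong_induction_on generalizing M N with
  | _ d ih =>
    rcases subsingleton_or_nontrivial N with hN | hN
    · exact ⟨0, fun x => ⟨0, Subsingleton.elim _ _⟩⟩
    obtain ⟨T, hT⟩ := IsSemisimpleModule.exists_simple_submodule A N
    obtain ⟨N', hN'⟩ := exists_isCompl T
    have hann (a : A) (ha : ∀ m : M, a • m = 0) (t : T) : a • t = 0 := by
      rw [← actionRank_eq_zero_iff (k := k)] at ha
      have hz : actionRank k N a = 0 := Nat.le_zero.1 (ha ▸ h a)
      exact Subtype.ext ((actionRank_eq_zero_iff a).1 hz t)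
    obtain ⟨S, ⟨e⟩⟩ :=
      IsSemisimpleModule.exists_linearEquiv_submodule_of_smul_eq_zero k (M := M) hann
    obtain ⟨M', hM'⟩ := exists_isCompl S
    have : Module.Finite k M' := inferInstanceAs (Module.Finite k (M'.restrictScalars k))
    have : Module.Finite k N' := inferInstanceAs (Module.Finite k (N'.restrictScalars k))
    have hrank (a : A) : actionRank k N' a ≤ actionRank k M' a := by
      have := h a
      rw [actionRank_of_isCompl hN', actionRank_of_isCompl hM', actionRank_congr e] at this
      omega
    have hlt : finrank k N' < d := by
      rw [← hd]
      refine Submodule.finrank_lt (s := N'.restrictScalars k) fun htop => ?_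
      have := IsSimpleModule.nontrivial A T
      have hbot : T = ⊥ := by
        rw [Submodule.restrictScalars_eq_top_iff] at htop
        simpa [htop] using hN'.inf_eq_bot
      exact (Submodule.nontrivial_iff_ne_bot.1 this) hbot
    obtain ⟨f, hf⟩ := ih _ hlt hrank rfl
    let eM := Submodule.prodEquivOfIsCompl S M' hM'
    let eN := Submodule.prodEquivOfIsCompl T N' hN'
    exact ⟨eN.toLinearMap ∘ₗ (e.symm.toLinearMap.prodMap f) ∘ₗ eM.symm.toLinearMap,
      eN.surjective.comp ((e.symm.surjective.prodMap hf).comp eM.symm.surjective)⟩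

end SemisimpleModules

theorem Submodule.eq_top_of_sup_jacobson_eq_top {A P : Type*} [Ring A] [AddCommGroup P] [Module A P]
    [Module.Finite A P] {N : Submodule A P} (h : N ⊔ Module.jacobson A P = ⊤) : N = ⊤ := by
  by_contra hN
  obtain ⟨m, hm, hle⟩ := (eq_top_or_exists_le_coatom N).resolve_left hN
  exact hm.1 (top_le_iff.1 (h ▸ sup_le hle (sInf_le hm)))

/-- Let `P` be a finite-dimensional projective module over a `k`-algebra `A`. If `k' ⊗[k] P` is a
quotient of `k' ⊗[k] D`, compatibly with the action of `A`, then `P` is a quotient of `D`. -/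
theorem exists_surjective_of_baseChange {k k' A D P : Type*} [Field k] [Field k'] [Algebra k k']
    [Ring A] [Algebra k A] [AddCommGroup D] [Module k D] [Module A D] [IsScalarTower k A D]
    [AddCommGroup P] [Module k P] [Module A P] [IsScalarTower k A P]
    [Module.Finite k D] [Module.Finite k P] [Module.Projective A P]
    (g : k' ⊗[k] D →ₗ[k'] k' ⊗[k] P) (hg : Function.Surjective g)
    (hA : ∀ (a : A) (x : k' ⊗[k] D), g ((Algebra.lsmul k k D a).baseChange k' x) =
      (Algebra.lsmul k k P a).baseChange k' (g x)) :
    ∃ f : D →ₗ[A] P, Function.Surjective f := by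
  have : IsArtinian A D := isArtinian_of_tower k inferInstance
  have : IsArtinian A P := isArtinian_of_tower k inferInstance
  have : Module.Finite A P := Module.Finite.of_restrictScalars_finite k A P
  let J := Module.jacobson A P
  have : IsSemisimpleModule A (P ⧸ J) :=
    (IsArtinian.isSemisimpleModule_iff_jacobson A _).2 (Module.jacobson_quotient_jacobson A P)
  obtain ⟨s, hs⟩ := Finset.exists_inf_le fun b : D →ₗ[A] P => J.comap b
  let B : D →ₗ[A] (s → P) := LinearMap.pi fun b => b.1
  let F : D →ₗ[A] (s → P ⧸ J) := LinearMap.pi fun b => J.mkQ ∘ₗ b.1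
  let K := LinearMap.ker F
  have hKJ (b : D →ₗ[A] P) (d : D) (hd : d ∈ K) : b d ∈ J :=
    hs b (Submodule.mem_finsetInf.2 fun i hi =>
      (Submodule.Quotient.mk_eq_zero J).1 (congrFun hd ⟨i, hi⟩))
  have hFinj : Function.Injective (K.liftQ F le_rfl) :=
    LinearMap.ker_eq_bot.1 (Submodule.ker_liftQ_eq_bot _ _ _ le_rfl)
  have : IsSemisimpleModule A (D ⧸ K) := .of_injective _ hFinj
  let π : D →ₗ[k] D ⧸ K := K.mkQ.restrictScalars k
  let q : P →ₗ[k] P ⧸ J := J.mkQ.restrictScalars k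
  have hπ : Function.Surjective π := K.mkQ_surjective
  have hq : Function.Surjective q := J.mkQ_surjective
  have : Module.Finite k (D ⧸ K) := .of_surjective π hπ
  have : Module.Finite k (P ⧸ J) := .of_surjective q hq
  have hvanish (d : D) (hd : d ∈ K) : q.baseChange k' (g (1 ⊗ₜ d)) = 0 := by
    refine TensorProduct.eq_zero_of_forall_rTensor_eq_zero _ fun φ => ?_
    have hcomm (y : k' ⊗[k] P) : TensorProduct.lid k (P ⧸ J) (φ.rTensor _ (q.baseChange k' y)) =
        q (TensorProduct.lid k P (φ.rTensor P y)) := by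
      induction y with
      | zero => simp
      | tmul c p => simp
      | add x y hx hy => simp only [map_add, hx, hy]
    have hsmul (a : A) (y : k' ⊗[k] P) :
        TensorProduct.lid k P (φ.rTensor P ((Algebra.lsmul k k P a).baseChange k' y)) =
          a • TensorProduct.lid k P (φ.rTensor P y) := by
      induction y with
      | zero => simp
      | tmul c p => simp [smul_algebra_smul_comm]
      | add x y hx hy => simp only [map_add, hx, hy, smul_add]
    let b : D →ₗ[A] P :=
      { toFun := fun d => TensorProduct.lid k P (φ.rTensor P (g (1 ⊗ₜ d)))
        map_add' := fun x y => by simp only [TensorProduct.tmul_add, map_add]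
        map_smul' := fun a x => by
          rw [RingHom.id_apply, ← hsmul, ← hA]
          simp }
    rw [hcomm]
    exact (Submodule.Quotient.mk_eq_zero J).2 (hKJ b d hd)
  obtain ⟨σ, hσ⟩ := π.exists_rightInverse_of_surjective (LinearMap.range_eq_top.2 hπ)
  let h : k' ⊗[k] (D ⧸ K) →ₗ[k'] k' ⊗[k] (P ⧸ J) := q.baseChange k' ∘ₗ g ∘ₗ σ.baseChange k'
  have hcomp (x : k' ⊗[k] D) : h (π.baseChange k' x) = q.baseChange k' (g x) := by
    induction x with
    | zero => simp
    | add x y hx hy => simp only [map_add, hx, hy]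
    | tmul c d =>
      have hmem : σ (π d) - d ∈ K := by
        rw [← Submodule.Quotient.mk_eq_zero]
        change π (σ (π d) - d) = 0
        rw [map_sub, ← LinearMap.comp_apply, hσ, LinearMap.id_apply, sub_self]
      have := hvanish _ hmem
      rw [TensorProduct.tmul_sub, map_sub, map_sub, sub_eq_zero] at this
      have hc (z : D) : c ⊗ₜ[k] z = c • ((1 : k') ⊗ₜ[k] z) := by
        rw [TensorProduct.smul_tmul', smul_eq_mul, mul_one]
      simp only [h, LinearMap.comp_apply, LinearMap.baseChange_tmul]
      rw [hc, hc, map_smul, map_smul, map_smul, map_smul, this]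
  have hπ' : Function.Surjective (π.baseChange k') := LinearMap.lTensor_surjective k' hπ
  have hq' : Function.Surjective (q.baseChange k') := LinearMap.lTensor_surjective k' hq
  have hsurj : Function.Surjective h := by
    refine Function.Surjective.of_comp (g := π.baseChange k') ?_
    rw [show ⇑h ∘ ⇑(π.baseChange k') = ⇑(q.baseChange k') ∘ ⇑g from funext hcomp]
    exact hq'.comp hg
  have hπa (a : A) (x : k' ⊗[k] D) : (Algebra.lsmul k k (D ⧸ K) a).baseChange k'
      (π.baseChange k' x) = π.baseChange k' ((Algebra.lsmul k k D a).baseChange k' x) := by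
    rw [← LinearMap.comp_apply, ← LinearMap.comp_apply, ← LinearMap.baseChange_comp,
      ← LinearMap.baseChange_comp]
    rfl
  have hqa (a : A) (x : k' ⊗[k] P) : (Algebra.lsmul k k (P ⧸ J) a).baseChange k'
      (q.baseChange k' x) = q.baseChange k' ((Algebra.lsmul k k P a).baseChange k' x) := by
    rw [← LinearMap.comp_apply, ← LinearMap.comp_apply, ← LinearMap.baseChange_comp,
      ← LinearMap.baseChange_comp]
    rfl
  have hha (a : A) : h ∘ₗ (Algebra.lsmul k k (D ⧸ K) a).baseChange k' =
      (Algebra.lsmul k k (P ⧸ J) a).baseChange k' ∘ₗ h := by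
    refine LinearMap.ext fun y => ?_
    obtain ⟨x, rfl⟩ := hπ' y
    change h (_ : k' ⊗[k] (D ⧸ K)) = (Algebra.lsmul k k (P ⧸ J) a).baseChange k' (h _)
    rw [hπa, hcomp, hcomp, hA, hqa]
  have hrank (a : A) : actionRank k (P ⧸ J) a ≤ actionRank k (D ⧸ K) a := by
    rw [actionRank, actionRank, ← finrank_range_baseChange k' (Algebra.lsmul k k (P ⧸ J) a),
      ← finrank_range_baseChange k' (Algebra.lsmul k k (D ⧸ K) a),
      ← LinearMap.range_comp_of_range_eq_top _ (LinearMap.range_eq_top.2 hsurj), ← hha,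
      LinearMap.range_comp]
    exact Submodule.finrank_map_le _ _
  obtain ⟨f, hf⟩ := IsSemisimpleModule.exists_surjective_of_actionRank_le hrank
  obtain ⟨E, hE⟩ := IsSemisimpleModule.extension_property _ hFinj f
  classical
  have : Module.Projective A (s → P) :=
    .of_equiv (DFinsupp.linearEquivFunOnFintype : (Π₀ _ : s, P) ≃ₗ[A] (s → P))
  obtain ⟨L, hL⟩ := Module.projective_lifting_property J.mkQ
    (E ∘ₗ LinearMap.pi fun i => J.mkQ ∘ₗ LinearMap.proj i : (s → P) →ₗ[A] P ⧸ J) J.mkQ_surjective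
  have hLB (d : D) : J.mkQ (L (B d)) = f (K.mkQ d) := by
    rw [← LinearMap.comp_apply, hL, ← hE]
    rfl
  refine ⟨L ∘ₗ B, LinearMap.range_eq_top.1 (Submodule.eq_top_of_sup_jacobson_eq_top ?_)⟩
  refine top_le_iff.1 fun p _ => ?_
  obtain ⟨d, hd⟩ := (hf.comp K.mkQ_surjective) (J.mkQ p)
  rw [Function.comp_apply, ← hLB] at hd
  have hmem : p - L (B d) ∈ J := by
    rw [← Submodule.Quotient.mk_eq_zero]
    exact sub_eq_zero.2 hd.symm
  rw [← add_sub_cancel (L (B d)) p]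
  exact Submodule.add_mem_sup ⟨d, rfl⟩ hmem

theorem mem_freeSummandRanks_iff {R V : Type*} [Ring R] [AddCommGroup V] [Module R V] {r : ℕ} :
    r ∈ FreeSummandRanks R V ↔ ∃ f : V →ₗ[R] (Fin r → R), Function.Surjective f := by
  constructor
  · rintro ⟨N, N', h, ⟨e⟩⟩
    exact ⟨e.toLinearMap ∘ₗ N.projectionOnto N' h,
      e.surjective.comp (LinearMap.range_eq_top.1 (Submodule.range_projectionOnto h))⟩
  · rintro ⟨f, hf⟩
    obtain ⟨s, hs⟩ := Module.projective_lifting_property f LinearMap.id hf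
    have hleft : Function.LeftInverse f s := LinearMap.congr_fun hs
    have hproj (x : LinearMap.range s) : (s.rangeRestrict ∘ₗ f) x = x := by
      obtain ⟨_, y, rfl⟩ := x
      exact Subtype.ext (congrArg s (hleft y))
    exact ⟨LinearMap.range s, _, LinearMap.isCompl_of_proj hproj,
      ⟨(LinearEquiv.ofInjective s hleft.injective).symm⟩⟩

/-- The group algebra over `k'` is the base change of the group algebra over `k`. -/
noncomputable def baseChangeMonoidAlgebraEquiv (k k' G : Type*) [Field k] [Field k'] [Algebra k k']
    [Group G] : k' ⊗[k] MonoidAlgebra k G ≃ₗ[k'] MonoidAlgebra k' G :=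
  ((MonoidAlgebra.basis G k).baseChange k').equiv (MonoidAlgebra.basis G k') (Equiv.refl G)

open MonoidAlgebra in
theorem baseChangeMonoidAlgebraEquiv_tmul_single {k k' G : Type*} [Field k] [Field k']
    [Algebra k k'] [Group G] (c : k') (h : G) (t : k) :
    baseChangeMonoidAlgebraEquiv k k' G (c ⊗ₜ single h t) = single h (t • c) := by
  have h1 : (single h t : MonoidAlgebra k G) = t • single h 1 := by simp
  have h2 : c ⊗ₜ[k] (single h t : MonoidAlgebra k G) =
      (t • c) • ((MonoidAlgebra.basis G k).baseChange k') h := by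
    rw [h1, ← TensorProduct.smul_tmul, Module.Basis.baseChange_apply, MonoidAlgebra.basis_apply,
      TensorProduct.smul_tmul', smul_eq_mul, mul_one]
  rw [h2, map_smul, baseChangeMonoidAlgebraEquiv, Module.Basis.equiv_apply,
    MonoidAlgebra.basis_apply]
  simp

open MonoidAlgebra in
theorem baseChangeMonoidAlgebraEquiv_tmul_single_mul {k k' G : Type*} [Field k] [Field k']
    [Algebra k k'] [Group G] (c : k') (g : G) (p : MonoidAlgebra k G) :
    baseChangeMonoidAlgebraEquiv k k' G (c ⊗ₜ (single g 1 * p)) =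
      single g 1 * baseChangeMonoidAlgebraEquiv k k' G (c ⊗ₜ p) := by
  induction p using MonoidAlgebra.induction_linear with
  | zero => simp
  | add x y hx hy => simp only [mul_add, TensorProduct.tmul_add, map_add, hx, hy]
  | single h t => simp [baseChangeMonoidAlgebraEquiv_tmul_single]

/-- Base change of the free module `k[G]^r` to `k'`. -/
noncomputable def baseChangeFreeEquiv (k k' G : Type*) [Field k] [Field k'] [Algebra k k'] [Group G]
    (r : ℕ) : k' ⊗[k] (Fin r → MonoidAlgebra k G) ≃ₗ[k'] (Fin r → MonoidAlgebra k' G) :=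
  TensorProduct.piRight k k' k' (fun _ : Fin r => MonoidAlgebra k G) ≪≫ₗ
    LinearEquiv.piCongrRight fun _ => baseChangeMonoidAlgebraEquiv k k' G

open MonoidAlgebra in
theorem baseChangeFreeEquiv_lsmul_single {k k' G : Type*} [Field k] [Field k'] [Algebra k k']
    [Group G] {r : ℕ} (g : G) (x : k' ⊗[k] (Fin r → MonoidAlgebra k G)) :
    baseChangeFreeEquiv k k' G r ((Algebra.lsmul k k _ (single g (1 : k))).baseChange k' x) =
      single g (1 : k') • baseChangeFreeEquiv k k' G r x := by
  induction x with
  | zero => simp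
  | add x y hx hy => simp only [map_add, hx, hy, smul_add]
  | tmul c p =>
    ext i : 1
    simp [baseChangeFreeEquiv, baseChangeMonoidAlgebraEquiv_tmul_single_mul]

open MonoidAlgebra in
theorem freeSummandRanks_repBaseChange {k G D : Type*} (k' : Type*) [Field k] [Field k']
    [Algebra k k'] [Group G] [Finite G] [AddCommGroup D] [Module k D] [Module.Finite k D]
    (ρ : Representation k G D) :
    FreeSummandRanks (MonoidAlgebra k' G) (repBaseChange k' ρ).asModule =
      FreeSummandRanks (MonoidAlgebra k G) ρ.asModule := by
  ext r
  refine (mem_freeSummandRanks_iff (R := MonoidAlgebra k' G)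
    (V := (repBaseChange k' ρ).asModule)).trans (Iff.trans ?_
      (mem_freeSummandRanks_iff (R := MonoidAlgebra k G) (V := ρ.asModule)).symm)
  have : Module.Finite k ρ.asModule := inferInstanceAs (Module.Finite k D)
  have : Module.Finite k (MonoidAlgebra k G) := .of_basis (MonoidAlgebra.basis G k)
  let e := baseChangeFreeEquiv k k' G r
  have hsmul (g : G) (x : k' ⊗[k] ρ.asModule) :
      (Algebra.lsmul k k ρ.asModule (single g (1 : k))).baseChange k' x =
        (single g (1 : k') • (show (repBaseChange k' ρ).asModule from x) :) := by
    rw [Representation.single_smul, one_smul]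
    have : (Algebra.lsmul k k ρ.asModule (single g (1 : k)) : ρ.asModule →ₗ[k] ρ.asModule) =
        ρ g := by
      ext d
      exact (Representation.single_smul (ρ := ρ) 1 g d).trans (one_smul _ _)
    rw [this]
    rfl
  constructor
  · rintro ⟨f, hf⟩
    let g : k' ⊗[k] ρ.asModule →ₗ[k'] k' ⊗[k] (Fin r → MonoidAlgebra k G) :=
      e.symm.toLinearMap ∘ₗ f.restrictScalars k'
    refine exists_surjective_of_baseChange g (e.symm.surjective.comp hf) fun a x => ?_
    induction a using MonoidAlgebra.induction_linear with
    | zero => simp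
    | add a b ha hb =>
      simp only [map_add, LinearMap.baseChange_add, LinearMap.add_apply, ha, hb]
    | single h t =>
      have ht : (single h t : MonoidAlgebra k G) = t • single h 1 := by simp
      rw [ht, map_smul, map_smul, LinearMap.baseChange_smul, LinearMap.baseChange_smul,
        LinearMap.smul_apply, LinearMap.smul_apply, LinearMap.map_smul_of_tower, hsmul]
      congr 1
      have heg (y : k' ⊗[k] ρ.asModule) : e (g y) = f y := e.apply_symm_apply _
      refine e.injective (Eq.trans ?_ (baseChangeFreeEquiv_lsmul_single h (g x)).symm)
      exact (heg _).trans ((f.map_smul (single h 1) x).trans (congrArg _ (heg x).symm))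
  · rintro ⟨f, hf⟩
    let f' := (f.restrictScalars k).baseChange k'
    have hf' : Function.Surjective f' := LinearMap.lTensor_surjective k' hf
    let F : (repBaseChange k' ρ).asModule →ₗ[k'] (Fin r → MonoidAlgebra k' G) :=
      e.toLinearMap ∘ₗ f'
    refine ⟨equivariantOfLinearOfComm F fun g x => ?_, e.surjective.comp hf'⟩
    have hcomm : f' ∘ₗ (Algebra.lsmul k k ρ.asModule (single g (1 : k))).baseChange k' =
        (Algebra.lsmul k k _ (single g (1 : k))).baseChange k' ∘ₗ f' := by
      rw [← LinearMap.baseChange_comp, ← LinearMap.baseChange_comp]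
      congr 1
      ext1 d
      exact f.map_smul _ _
    refine Eq.trans ?_ (baseChangeFreeEquiv_lsmul_single g (f' x))
    exact congrArg e ((congrArg f' (hsmul g x).symm).trans (LinearMap.congr_fun hcomm x))

/-- Let `k ⊆ k'` be an algebraic extension of fields, `G` a finite group and `D`
a finitely generated `kG`-module.  The largest `r` such that `(kG)^r` is a direct summand of
`D` equals the largest `r'` such that `(k'G)^{r'}` is a direct summand of `k' ⊗_k D`;
consequently the codimension of a maximal free summand is preserved under base change. -/
theorem stmt_7 (k k' G : Type*) [Field k] [Field k'] [Algebra k k']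
    [Algebra.IsAlgebraic k k'] [Group G] [Finite G]
    (D : Type*) [AddCommGroup D] [Module k D] [Module.Finite k D]
    (ρ : Representation k G D) :
    (∀ r : ℕ,
      IsGreatest (FreeSummandRanks (MonoidAlgebra k G) ρ.asModule) r ↔
        IsGreatest (FreeSummandRanks (MonoidAlgebra k' G) (repBaseChange k' ρ).asModule) r) ∧
    (∀ r : ℕ, IsGreatest (FreeSummandRanks (MonoidAlgebra k G) ρ.asModule) r →
      Module.finrank k' (k' ⊗[k] D) - Nat.card G * r = Module.finrank k D - Nat.card G * r) := by
  have h := freeSummandRanks_repBaseChange k' ρ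
  exact ⟨fun r => by rw [h], fun r _ => by rw [Module.finrank_baseChange]⟩
end

section
/- Let G be a finite group, let k ⊆ k' be an algebraic extension of fields, and let (M_n)_{n ≥ 0} be a sequence of finite-dimensional kG-modules. Suppose the sequence (k' ⊗_k M_n)_n admits a polynomial description of degree d over k'G: that is, there exist an integer m > 0, a finite set U' of finite-dimensional indecomposable k'G-modules, and for each 0 ≤ a < m and T' ∈ U' a polynomial P_{a,T'}(t) ∈ ℚ[t] (not all zero, each taking integer values at all sufficiently large integers t, with maximum degree d) such that for all sufficiently large integers t each P_{a,T'}(t) ≥ 0 and k' ⊗_k M_{tm+a} ≅ ⊕_{T' ∈ U'} (T')^{P_{a,T'}(t)} as k'G-modules. Then (M_n)_n admits a polynomial description of degree d over kG: there exist an integer m > 0, a finite set U of finite-dimensional indecomposable kG-modules, and polynomials P_{a,T}(t) ∈ ℚ[t] with the same properties such that M_{tm+a} ≅ ⊕_{T ∈ U} T^{P_{a,T}(t)} as kG-modules for all sufficiently large t. -/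
open TensorProduct

/-- A module is indecomposable if it is nonzero and is not the direct sum of two
nonzero submodules. -/
def IsIndecomposableModule (R V : Type*) [Ring R] [AddCommMonoid V] [Module R V] : Prop :=
  Nontrivial V ∧ ∀ (N N' : Submodule R V), IsCompl N N' → N = ⊥ ∨ N' = ⊥

universe u v

/-- A sequence of `R`-modules `M n` has a polynomial description of degree `d` if there are
an integer `m > 0`, a finite set `T 0, …, T (s-1)` of finitely generated indecomposable
`R`-modules and polynomials `P a j ∈ ℚ[t]` (for `0 ≤ a < m`, `0 ≤ j < s`, for each `j`
nonzero for at least one `a`, of maximal degree `d`) such that for all sufficiently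
large `t` each `P a j` takes a nonnegative integer value `e j` at `t` and
`M (t*m + a) ≅ ⊕_j (T j)^(e j)`. -/
def HasPolyDescriptionOfDeg (R : Type u) [Ring R] (M : ℕ → Type v)
    [∀ n, AddCommMonoid (M n)] [∀ n, Module R (M n)] (d : ℕ) : Prop :=
  ∃ (m : ℕ), 0 < m ∧ ∃ (s : ℕ) (T : Fin s → ModuleCat.{v} R) (P : Fin m → Fin s → Polynomial ℚ),
    (∀ j, IsIndecomposableModule R (T j)) ∧
    (∀ j, Module.Finite R (T j)) ∧
    (∀ j, ∃ a, P a j ≠ 0) ∧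
    (∀ a j, (P a j).natDegree ≤ d) ∧
    (∃ a j, P a j ≠ 0 ∧ (P a j).natDegree = d) ∧
    ∃ t₀ : ℕ, ∀ t : ℕ, t₀ ≤ t → ∀ a : Fin m, ∃ e : Fin s → ℕ,
      (∀ j, (P a j).eval (t : ℚ) = (e j : ℚ)) ∧
      Nonempty (M (t * m + (a : ℕ)) ≃ₗ[R] Π j : Fin s, (Fin (e j) → T j))


section Indecomposable

variable {R : Type*} [Ring R]

/-- `X` is a retract of `V` if the identity of `X` factors through `V`. -/
def IsModuleRetract (R X V : Type*) [Ring R] [AddCommGroup X] [Module R X] [AddCommGroup V]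
    [Module R V] : Prop :=
  ∃ (i : X →ₗ[R] V) (p : V →ₗ[R] X), p ∘ₗ i = LinearMap.id

section Retract

variable {X Y V : Type*} [AddCommGroup X] [Module R X] [AddCommGroup Y] [Module R Y]
  [AddCommGroup V] [Module R V]

lemma IsModuleRetract.of_equiv (e : X ≃ₗ[R] V) : IsModuleRetract R X V :=
  ⟨e, e.symm, by ext; simp⟩

lemma IsModuleRetract.trans (h : IsModuleRetract R X Y) (h' : IsModuleRetract R Y V) :
    IsModuleRetract R X V := by
  obtain ⟨i, p, h⟩ := h
  obtain ⟨j, q, h'⟩ := h'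
  refine ⟨j ∘ₗ i, p ∘ₗ q, ?_⟩
  ext x
  have h1 := LinearMap.congr_fun h x
  exact (congrArg p (LinearMap.congr_fun h' (i x))).trans h1

lemma isModuleRetract_pi {ι : Type*} (W : ι → Type*) [∀ i, AddCommGroup (W i)]
    [∀ i, Module R (W i)] (i : ι) : IsModuleRetract R (W i) (Π i, W i) := by
  classical
  exact ⟨LinearMap.single R W i, LinearMap.proj i, by ext; simp⟩

lemma IsModuleRetract.of_isUnit {f : X →ₗ[R] V} {g : V →ₗ[R] X}
    (h : IsUnit (g ∘ₗ f : Module.End R X)) : IsModuleRetract R X V := by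
  obtain ⟨u, hu⟩ := h
  refine ⟨f, (↑u⁻¹ : Module.End R X) ∘ₗ g, ?_⟩
  rw [LinearMap.comp_assoc, ← hu]
  exact u.inv_mul

/-- A nonzero retract of an indecomposable module is the whole module. -/
lemma IsModuleRetract.nonempty_equiv [Nontrivial X] (h : IsModuleRetract R X V)
    (hV : IsIndecomposableModule R V) : Nonempty (X ≃ₗ[R] V) := by
  obtain ⟨i, p, h⟩ := h
  have hpi : ∀ x, p (i x) = x := fun x => LinearMap.congr_fun h x
  have hc : IsCompl (LinearMap.range i) (LinearMap.ker p) := by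
    rw [isCompl_iff, Submodule.disjoint_def, codisjoint_iff, eq_top_iff]
    constructor
    · rintro _ ⟨x, rfl⟩ hx
      rw [LinearMap.mem_ker, hpi] at hx
      simp [hx]
    · intro v _
      rw [Submodule.mem_sup]
      exact ⟨i (p v), ⟨_, rfl⟩, v - i (p v), by simp [hpi], by simp⟩
  have hinj : Function.Injective i := Function.LeftInverse.injective hpi
  rcases hV.2 _ _ hc with h0 | h0
  · obtain ⟨x, hx⟩ := exists_ne (0 : X)
    exact absurd (hinj (((LinearMap.range_eq_bot.mp h0 ▸ rfl : i x = 0)).trans (map_zero i).symm)) hx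
  · refine ⟨LinearEquiv.ofBijective i ⟨hinj, fun v => ⟨p v, ?_⟩⟩⟩
    exact LinearMap.ker_eq_bot.mp h0 (hpi _)

end Retract

section Fitting

variable {X : Type*} [AddCommGroup X] [Module R X] [IsArtinian R X] [IsNoetherian R X]

lemma IsIndecomposableModule.isNilpotent_or_isUnit (hX : IsIndecomposableModule R X)
    (f : Module.End R X) : IsNilpotent f ∨ IsUnit f := by
  obtain ⟨n, hn⟩ := Filter.eventually_atTop.mp
    (LinearMap.eventually_isCompl_ker_pow_range_pow f)
  rcases hX.2 _ _ (hn (n + 1) (by omega)) with h | h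
  · right
    rw [Module.End.isUnit_iff]
    apply IsArtinian.bijective_of_injective_endomorphism
    rw [LinearMap.ker_eq_bot, Module.End.coe_pow] at h
    exact Function.Injective.of_comp (f := f^[n]) (by rwa [Function.iterate_succ] at h)
  · left
    exact ⟨n + 1, LinearMap.range_eq_bot.mp h⟩

lemma IsIndecomposableModule.isLocalRing_end (hX : IsIndecomposableModule R X) :
    IsLocalRing (Module.End R X) := by
  have := hX.1
  refine IsLocalRing.of_isUnit_or_isUnit_one_sub_self fun f => ?_
  rcases hX.isNilpotent_or_isUnit f with h | h
  · exact Or.inr h.isUnit_one_sub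
  · exact Or.inl h

end Fitting

lemma IsModuleRetract.exists_of_pi {X : Type*} [AddCommGroup X] [Module R X]
    [IsLocalRing (Module.End R X)] {ι : Type*} [Fintype ι] {W : ι → Type*}
    [∀ i, AddCommGroup (W i)] [∀ i, Module R (W i)] (h : IsModuleRetract R X (Π i, W i)) :
    ∃ i, IsModuleRetract R X (W i) := by
  classical
  obtain ⟨f, p, h⟩ := h
  have hsum : ∑ i, (p ∘ₗ LinearMap.single R W i) ∘ₗ (LinearMap.proj i ∘ₗ f) =
      (1 : Module.End R X) := by
    rw [Module.End.one_eq_id, ← h]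
    ext x
    simp only [LinearMap.sum_apply, LinearMap.comp_apply, LinearMap.proj_apply, ← map_sum]
    congr 1
    exact Finset.univ_sum_single (f x)
  obtain ⟨i, -, hi⟩ := IsLocalRing.exists_of_isUnit_sum
    (R := Module.End R X) (s := Finset.univ)
    (f := fun i => (p ∘ₗ LinearMap.single R W i) ∘ₗ (LinearMap.proj i ∘ₗ f))
    (by rw [hsum]; exact isUnit_one)
  exact ⟨i, .of_isUnit hi⟩

/-- A submodule of an Artinian module is a finite product of indecomposable submodules. -/
lemma exists_equiv_pi_indecomposable {V : Type*} [AddCommGroup V] [Module R V] [IsArtinian R V]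
    (W : Submodule R V) : ∃ (ι : Type) (_ : Fintype ι) (N : ι → Submodule R V),
      (∀ i, IsIndecomposableModule R (N i)) ∧ Nonempty (W ≃ₗ[R] Π i, N i) := by
  induction W using WellFoundedLT.induction with
  | ind W ih =>
    by_cases hW : Nontrivial W
    · by_cases hI : IsIndecomposableModule R W
      · refine ⟨Unit, inferInstance, fun _ => W, fun _ => hI, ⟨?_⟩⟩
        exact (LinearEquiv.funUnique Unit R W).symm
      · simp only [IsIndecomposableModule, hW, true_and, not_forall, not_or] at hI
        obtain ⟨A, B, hAB, hA, hB⟩ := hI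
        have hlt : ∀ C : Submodule R W, C ≠ ⊤ → C.map W.subtype < W := by
          intro C hC
          refine lt_of_le_of_ne (Submodule.map_subtype_le W C) fun h => hC ?_
          apply Submodule.map_injective_of_injective W.injective_subtype
          rw [h, Submodule.map_subtype_top]
        have hA' : A ≠ ⊤ := fun h => hB (by simpa [h] using hAB.inf_eq_bot)
        have hB' : B ≠ ⊤ := fun h => hA (by simpa [h] using hAB.inf_eq_bot)
        obtain ⟨ι₁, _, N₁, h₁, ⟨e₁⟩⟩ := ih _ (hlt A hA')
        obtain ⟨ι₂, _, N₂, h₂, ⟨e₂⟩⟩ := ih _ (hlt B hB')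
        refine ⟨ι₁ ⊕ ι₂, inferInstance, Sum.elim N₁ N₂, ?_, ⟨?_⟩⟩
        · rintro (i | i)
          exacts [h₁ i, h₂ i]
        · refine (Submodule.prodEquivOfIsCompl A B hAB).symm ≪≫ₗ ?_ ≪≫ₗ
            (LinearEquiv.sumPiEquivProdPi R ι₁ ι₂
              (fun i => (Sum.elim N₁ N₂ i : Submodule R V))).symm
          exact LinearEquiv.prodCongr
            ((Submodule.equivMapOfInjective _ W.injective_subtype A) ≪≫ₗ e₁)
            ((Submodule.equivMapOfInjective _ W.injective_subtype B) ≪≫ₗ e₂)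
    · rw [not_nontrivial_iff_subsingleton] at hW
      refine ⟨Empty, inferInstance, fun i => i.elim, fun i => i.elim, ⟨?_⟩⟩
      exact LinearEquiv.ofSubsingleton _ _

lemma finite_linearMap_of_tower (K : Type*) [Field K] [Algebra K R] {X V : Type*}
    [AddCommGroup X] [Module R X] [AddCommGroup V] [Module R V] [Module K V] [IsScalarTower K R V]
    [Module K X] [IsScalarTower K R X] [Module.Finite K X]
    [Module.Finite K V] : Module.Finite K (X →ₗ[R] V) := by
  let E : (X →ₗ[R] V) →ₗ[K] (X →ₗ[K] V) :=
    { toFun := fun f => f.restrictScalars K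
      map_add' := fun f g => rfl
      map_smul' := fun c f => rfl }
  exact Module.Finite.of_injective E fun f g h => by
    ext x
    exact LinearMap.congr_fun h x

section RadicalQuotient

variable (K : Type*) [Field K] [Algebra K R]
variable (R) (X : Type*) [AddCommGroup X] [Module R X]
  [IsLocalRing (Module.End R X)]

/-- The maps `X → V` that are not split monomorphisms. -/
def radHom (V : Type*) [AddCommGroup V] [Module R V] [Module K V] [IsScalarTower K R V] :
    Submodule K (X →ₗ[R] V) where
  carrier := {f | ∀ g : V →ₗ[R] X, ¬ IsUnit (g ∘ₗ f : Module.End R X)}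
  add_mem' {a b} ha hb g := by
    rw [LinearMap.comp_add]
    exact IsLocalRing.nonunits_add (ha g) (hb g)
  zero_mem' g := by
    rw [LinearMap.comp_zero]
    exact not_isUnit_zero
  smul_mem' c f hf g := by
    have := IsScalarTower.to_smulCommClass (R := K) (A := R) (M := V)
    exact hf (g ∘ₗ (c • LinearMap.id))

/-- For `X` with local endomorphism ring, a positive multiple of the multiplicity of `X` as a
direct summand of `V`. -/
noncomputable def radMult (V : Type*) [AddCommGroup V] [Module R V] [Module K V]
    [IsScalarTower K R V] : ℕ :=
  Module.finrank K ((X →ₗ[R] V) ⧸ radHom R K X V)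

variable {R X}

section

variable {V W : Type*} [AddCommGroup V] [Module R V] [Module K V] [IsScalarTower K R V]
  [AddCommGroup W] [Module R W] [Module K W] [IsScalarTower K R W]

lemma radMult_congr (e : V ≃ₗ[R] W) : radMult R K X V = radMult R K X W := by
  let E : (X →ₗ[R] V) ≃ₗ[K] (X →ₗ[R] W) :=
    { toFun := fun f => e.toLinearMap ∘ₗ f
      invFun := fun f => e.symm.toLinearMap ∘ₗ f
      map_add' := fun f g => LinearMap.comp_add _ _ _
      map_smul' := fun c f => by
        ext x
        exact (e.toLinearMap.restrictScalars K).map_smul c (f x)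
      left_inv := fun f => by ext; simp
      right_inv := fun f => by ext; simp }
  refine (Submodule.Quotient.equiv _ _ E ?_).finrank_eq
  ext f
  rw [Submodule.mem_map_equiv]
  constructor
  · intro h g
    have := h (g ∘ₗ e.toLinearMap)
    convert this using 2
    ext x
    exact congrArg g (e.apply_symm_apply (f x)).symm
  · intro h g
    exact h (g ∘ₗ e.symm.toLinearMap)

lemma radMult_eq_zero (h : ¬ IsModuleRetract R X V) : radMult R K X V = 0 := by
  have : radHom R K X V = ⊤ := by
    rw [eq_top_iff]
    exact fun f _ g hg => h (.of_isUnit hg)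
  rw [radMult, this]
  exact Module.finrank_zero_of_subsingleton

lemma radMult_ne_zero [Module K X] [IsScalarTower K R X] [Module.Finite K X] [Module.Finite K V]
    (h : IsModuleRetract R X V) : radMult R K X V ≠ 0 := by
  have := finite_linearMap_of_tower K (R := R) (X := X) (V := V)
  obtain ⟨i, p, h⟩ := h
  have : Nontrivial ((X →ₗ[R] V) ⧸ radHom R K X V) := by
    rw [Submodule.Quotient.nontrivial_iff]
    intro htop
    have hi : i ∈ radHom R K X V := htop ▸ Submodule.mem_top
    exact hi p (h ▸ isUnit_one)
  exact (Module.finrank_pos (R := K)).ne'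

end

lemma radMult_pi {ι : Type*} [Fintype ι] (W : ι → Type*) [∀ i, AddCommGroup (W i)]
    [∀ i, Module R (W i)] [∀ i, Module K (W i)] [∀ i, IsScalarTower K R (W i)]
    [Module K X] [IsScalarTower K R X] [Module.Finite K X] [∀ i, Module.Finite K (W i)] :
    radMult R K X (Π i, W i) = ∑ i, radMult R K X (W i) := by
  classical
  have := fun i => finite_linearMap_of_tower K (R := R) (X := X) (V := W i)
  let E : (X →ₗ[R] Π i, W i) ≃ₗ[K] (Π i, X →ₗ[R] W i) :=
    { toFun := fun f i => LinearMap.proj i ∘ₗ f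
      invFun := fun f => LinearMap.pi f
      map_add' := fun f g => rfl
      map_smul' := fun c f => rfl
      left_inv := fun f => rfl
      right_inv := fun f => rfl }
  have key : (radHom R K X (Π i, W i)).map E.toLinearMap =
      Submodule.pi Set.univ fun i => radHom R K X (W i) := by
    ext f
    rw [Submodule.mem_map_equiv, Submodule.mem_pi]
    constructor
    · intro h i _ g
      exact h (g ∘ₗ LinearMap.proj i)
    · intro h g hg
      have hsum : g ∘ₗ LinearMap.pi f =
          ∑ i, ((g ∘ₗ LinearMap.single R W i) ∘ₗ f i : Module.End R X) := by
        ext x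
        simp only [LinearMap.sum_apply, LinearMap.comp_apply, ← map_sum]
        congr 1
        exact (Finset.univ_sum_single fun i => f i x).symm
      change IsUnit (g ∘ₗ LinearMap.pi f : Module.End R X) at hg
      rw [hsum] at hg
      obtain ⟨i, -, hi⟩ := IsLocalRing.exists_of_isUnit_sum hg
      exact h i (Set.mem_univ i) _ hi
  rw [radMult, (Submodule.Quotient.equiv _ _ E key).finrank_eq,
    (Submodule.quotientPi fun i => radHom R K X (W i)).finrank_eq, Module.finrank_pi_fintype]
  rfl

end RadicalQuotient

open Pointwise in
/-- The non-invertible endomorphisms of an indecomposable module form a nilpotent set. -/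
lemma IsIndecomposableModule.exists_nonunits_pow_subset {X : Type*} [AddCommGroup X] [Module R X]
    [IsArtinian R X] [IsNoetherian R X] [IsArtinianRing (Module.End R X)]
    (hX : IsIndecomposableModule R X) : ∃ n : ℕ, nonunits (Module.End R X) ^ n ⊆ {0} := by
  obtain ⟨n, hn⟩ := IsArtinianRing.isNilpotent_jacobson_bot (R := Module.End R X)
  have hJ : nonunits (Module.End R X) ⊆ (Ideal.jacobson ⊥ : Ideal (Module.End R X)) := by
    intro f hf
    rw [SetLike.mem_coe, Ideal.mem_jacobson_iff]
    intro y
    have hyf : IsNilpotent (y * f) := by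
      refine (hX.isNilpotent_or_isUnit _).resolve_right fun h => hf ?_
      rw [Module.End.isUnit_iff] at h ⊢
      exact IsArtinian.bijective_of_injective_endomorphism _ (.of_comp h.1)
    obtain ⟨u, hu⟩ := hyf.isUnit_one_add
    refine ⟨↑u⁻¹, ?_⟩
    rw [Ideal.mem_bot, mul_assoc, ← mul_add_one, add_comm (y * f), ← hu, Units.inv_mul, sub_self]
  have hpow : ∀ m : ℕ, nonunits (Module.End R X) ^ m ⊆
      ((Ideal.jacobson ⊥ ^ m : Ideal (Module.End R X)) : Set (Module.End R X)) := by
    intro m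
    induction m with
    | zero =>
      rw [pow_zero, Submodule.pow_zero, Ideal.one_eq_top]
      exact fun _ _ => Submodule.mem_top
    | succ m ih =>
      rw [pow_succ, Submodule.pow_succ]
      rintro _ ⟨a, ha, b, hb, rfl⟩
      exact Ideal.mul_mem_mul (ih ha) (hJ hb)
  refine ⟨n, (hpow n).trans ?_⟩
  rw [hn]
  simp

end Indecomposable

section BaseChange

open MonoidAlgebra

variable {k : Type*} (k' : Type*) {G : Type*} [Field k] [Field k'] [Algebra k k'] [Group G]

section Defs

variable (k G) (N : Type*) [AddCommGroup N] [Module k N]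
  [Module (MonoidAlgebra k G) N] [IsScalarTower k (MonoidAlgebra k G) N]

/-- The `k'G`-module `k' ⊗[k] N` attached to a `kG`-module `N`. -/
def GroupBaseChange : Type _ :=
  (repBaseChange k' (Representation.ofModule' (k := k) (G := G) N)).asModule

namespace GroupBaseChange

noncomputable instance : AddCommGroup (GroupBaseChange k k' G N) :=
  inferInstanceAs (AddCommGroup (Representation.asModule _))

noncomputable instance : Module (MonoidAlgebra k' G) (GroupBaseChange k k' G N) :=
  inferInstanceAs (Module (MonoidAlgebra k' G) (Representation.asModule _))

noncomputable instance : Module k' (GroupBaseChange k k' G N) :=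
  inferInstanceAs (Module k' (Representation.asModule _))

instance : IsScalarTower k' (MonoidAlgebra k' G) (GroupBaseChange k k' G N) :=
  inferInstanceAs (IsScalarTower k' (MonoidAlgebra k' G) (Representation.asModule _))

/-- The underlying vector space of the base change is the tensor product. -/
noncomputable def toTensor : GroupBaseChange k k' G N ≃ₗ[k'] k' ⊗[k] N :=
  Representation.asModuleEquiv _

end GroupBaseChange

end Defs

variable {N N' N'' : Type*} [AddCommGroup N] [Module k N]
  [Module (MonoidAlgebra k G) N] [IsScalarTower k (MonoidAlgebra k G) N]
  [AddCommGroup N'] [Module k N']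
  [Module (MonoidAlgebra k G) N'] [IsScalarTower k (MonoidAlgebra k G) N']
  [AddCommGroup N''] [Module k N'']
  [Module (MonoidAlgebra k G) N''] [IsScalarTower k (MonoidAlgebra k G) N'']

namespace GroupBaseChange

variable (k G) in
/-- A pure tensor, as an element of the base change. -/
noncomputable def tmul (a : k') (n : N) : GroupBaseChange k k' G N :=
  (toTensor k k' G N).symm (a ⊗ₜ[k] n)

variable {k'}

@[elab_as_elim]
lemma induction_on {p : GroupBaseChange k k' G N → Prop} (x : GroupBaseChange k k' G N)
    (zero : p 0) (tmul : ∀ a n, p (tmul k k' G a n)) (add : ∀ x y, p x → p y → p (x + y)) : p x :=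
  TensorProduct.induction_on (motive := p) x zero tmul add

@[ext]
lemma hom_ext {V : Type*} [AddCommMonoid V] [Module (MonoidAlgebra k' G) V]
    {f g : GroupBaseChange k k' G N →ₗ[MonoidAlgebra k' G] V}
    (h : ∀ a n, f (tmul k k' G a n) = g (tmul k k' G a n)) : f = g := by
  ext x
  induction x using induction_on with
  | zero => rw [map_zero, map_zero]
  | tmul a n => exact h a n
  | add x y hx hy => rw [map_add, map_add, hx, hy]

lemma single_smul_tmul (g : G) (a : k') (n : N) :
    (single g (1 : k') : MonoidAlgebra k' G) • tmul k k' G a n =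
      tmul k k' G a ((single g (1 : k) : MonoidAlgebra k G) • n) := by
  refine (Representation.single_smul (repBaseChange k' (Representation.ofModule' N)) 1 g
    (tmul k k' G a n)).trans ?_
  rw [one_smul]
  rfl

lemma smul_tmul (c a : k') (n : N) : c • tmul k k' G a n = tmul k k' G (c * a) n := rfl

variable (k' G) in
/-- The base change of a `kG`-linear map. -/
noncomputable def map (f : N →ₗ[MonoidAlgebra k G] N') :
    GroupBaseChange k k' G N →ₗ[MonoidAlgebra k' G] GroupBaseChange k k' G N' :=
  equivariantOfLinearOfComm ((toTensor k k' G N').symm.toLinearMap ∘ₗ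
    (f.restrictScalars k).baseChange k' ∘ₗ (toTensor k k' G N).toLinearMap)
    fun g v => by
      induction v using induction_on with
      | zero => rw [smul_zero, map_zero, smul_zero]
      | add x y hx hy => rw [smul_add, map_add, hx, hy, map_add, smul_add]
      | tmul a n =>
        rw [single_smul_tmul]
        refine Eq.trans ?_ (single_smul_tmul g a (f n)).symm
        rw [← map_smul f]
        rfl

@[simp]
lemma map_tmul (f : N →ₗ[MonoidAlgebra k G] N') (a : k') (n : N) :
    map k' G f (tmul k k' G a n) = tmul k k' G a (f n) := rfl

lemma map_id : map k' G (LinearMap.id : N →ₗ[MonoidAlgebra k G] N) = LinearMap.id := by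
  ext; simp

lemma map_zero_hom : map k' G (0 : N →ₗ[MonoidAlgebra k G] N') = 0 := by
  ext a n
  exact TensorProduct.tmul_zero _ a

lemma map_comp (f : N' →ₗ[MonoidAlgebra k G] N'') (g : N →ₗ[MonoidAlgebra k G] N') :
    map k' G (f ∘ₗ g) = map k' G f ∘ₗ map k' G g := by
  ext; simp

variable (k' G) in
lemma isModuleRetract (h : IsModuleRetract (MonoidAlgebra k G) N N') :
    IsModuleRetract (MonoidAlgebra k' G) (GroupBaseChange k k' G N) (GroupBaseChange k k' G N') := by
  obtain ⟨i, p, h⟩ := h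
  exact ⟨map k' G i, map k' G p, by rw [← map_comp, h, map_id]⟩

variable (k' G) in
/-- The base change of a `kG`-linear equivalence. -/
noncomputable def congr (e : N ≃ₗ[MonoidAlgebra k G] N') :
    GroupBaseChange k k' G N ≃ₗ[MonoidAlgebra k' G] GroupBaseChange k k' G N' :=
  LinearEquiv.ofLinearMap (map k' G e.toLinearMap) (map k' G e.symm.toLinearMap)
    (by ext; simp) (by ext; simp)

instance [Nontrivial N] : Nontrivial (GroupBaseChange k k' G N) :=
  inferInstanceAs (Nontrivial (k' ⊗[k] N))

/-- Base change commutes with finite products. -/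
noncomputable def piEquiv {ι : Type*} [Fintype ι] (W : ι → Type*)
    [∀ i, AddCommGroup (W i)] [∀ i, Module k (W i)] [∀ i, Module (MonoidAlgebra k G) (W i)]
    [∀ i, IsScalarTower k (MonoidAlgebra k G) (W i)] :
    GroupBaseChange k k' G (Π i, W i) ≃ₗ[MonoidAlgebra k' G]
      Π i, GroupBaseChange k k' G (W i) := by
  classical
  refine LinearEquiv.ofLinearMap (LinearMap.pi fun i => map k' G (LinearMap.proj i))
    (∑ i, map k' G (LinearMap.single _ W i) ∘ₗ LinearMap.proj i) ?_ ?_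
  · refine LinearMap.ext fun x => funext fun j => ?_
    simp only [LinearMap.comp_apply, LinearMap.pi_apply, LinearMap.sum_apply, LinearMap.proj_apply,
      map_sum, LinearMap.id_apply]
    rw [Finset.sum_eq_single j]
    · rw [← LinearMap.comp_apply, ← map_comp, LinearMap.proj_comp_single_same, map_id,
        LinearMap.id_apply]
    · intro i _ hij
      rw [← LinearMap.comp_apply, ← map_comp, LinearMap.proj_comp_single_ne _ _ _ _ hij.symm,
        map_zero_hom, LinearMap.zero_apply]
    · exact fun h => absurd (Finset.mem_univ j) h
  · ext a n
    simp only [LinearMap.comp_apply, LinearMap.sum_apply, LinearMap.proj_apply, LinearMap.pi_apply,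
      map_tmul, LinearMap.id_apply]
    refine (TensorProduct.tmul_sum a Finset.univ fun i => LinearMap.single _ W i (n i)).symm.trans ?_
    exact congrArg (tmul k k' G a) (Finset.univ_sum_single n)

/-- For a representation, the two natural base changes agree. -/
lemma nonempty_equiv_asModule {V : Type*} [AddCommGroup V] [Module k V]
    (ρ : Representation k G V) : Nonempty
      ((repBaseChange k' ρ).asModule ≃ₗ[MonoidAlgebra k' G] GroupBaseChange k k' G ρ.asModule) := by
  have : Representation.ofModule' (k := k) (G := G) ρ.asModule = ρ := by
    ext g v
    refine (Representation.single_smul ρ 1 g v).trans ?_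
    rw [one_smul]
    rfl
  have aux : ∀ σ : Representation k G V, σ = ρ → Nonempty
      ((repBaseChange k' ρ).asModule ≃ₗ[MonoidAlgebra k' G] (repBaseChange k' σ).asModule) := by
    rintro _ rfl
    exact ⟨LinearEquiv.refl _ _⟩
  exact aux _ this

/-- Every map between base changes is a linear combination of base changes of maps. -/
lemma mem_span_range_map [Module.Finite k N]
    (f : GroupBaseChange k k' G N →ₗ[MonoidAlgebra k' G] GroupBaseChange k k' G N') :
    f ∈ Submodule.span k' (Set.range (map k' G : (N →ₗ[MonoidAlgebra k G] N') → _)) := by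
  classical
  let b := Module.Basis.ofVectorSpace k k'
  let E : k' ⊗[k] N' ≃ₗ[k] _ := TensorProduct.equivFinsuppOfBasisLeft b
  let f₀ : k' ⊗[k] N →ₗ[k'] k' ⊗[k] N' := (toTensor k k' G N').toLinearMap ∘ₗ
    f.restrictScalars k' ∘ₗ (toTensor k k' G N).symm.toLinearMap
  let c (i) : N →ₗ[k] N' := Finsupp.lapply i ∘ₗ E.toLinearMap ∘ₗ f₀.restrictScalars k ∘ₗ
    TensorProduct.mk k k' N 1
  have hE : ∀ (g : G) (i) (x : GroupBaseChange k k' G N'),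
      E (toTensor k k' G N' ((single g (1 : k') : MonoidAlgebra k' G) • x)) i =
      (single g (1 : k) : MonoidAlgebra k G) • E (toTensor k k' G N' x) i := by
    intro g i x
    induction x using induction_on with
    | zero => simp only [smul_zero, map_zero, Finsupp.zero_apply]
    | add x y hx hy => simp only [smul_add, map_add, Finsupp.add_apply, hx, hy]
    | tmul a n =>
      rw [single_smul_tmul]
      simp only [tmul, LinearEquiv.apply_symm_apply, E,
        TensorProduct.equivFinsuppOfBasisLeft_apply_tmul_apply]
      rw [smul_comm]
  let d (i) : N →ₗ[MonoidAlgebra k G] N' := equivariantOfLinearOfComm (c i) fun g n => by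
    refine Eq.trans ?_ (hE g i (f (tmul k k' G 1 n)))
    rw [← map_smul, single_smul_tmul]
    rfl
  obtain ⟨s, hs⟩ := Module.Finite.fg_top (R := k) (M := N)
  let F := s.biUnion fun n => (E (f₀ (1 ⊗ₜ n))).support
  have hF : ∀ i ∉ F, ∀ n, c i n = 0 := by
    intro i hi
    suffices c i = 0 from LinearMap.congr_fun this
    refine LinearMap.ext_on hs fun n hn => ?_
    by_contra h
    exact hi (Finset.mem_biUnion.mpr ⟨n, hn, Finsupp.mem_support_iff.mpr h⟩)
  have hsum : ∀ n, f₀ (1 ⊗ₜ n) = ∑ i ∈ F, b i ⊗ₜ[k] c i n := by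
    intro n
    rw [← E.symm_apply_apply (f₀ (1 ⊗ₜ n)), TensorProduct.equivFinsuppOfBasisLeft_symm_apply]
    refine Finsupp.sum_of_support_subset _ (fun i hi => ?_) _ fun i _ => TensorProduct.tmul_zero _ _
    by_contra h
    exact Finsupp.mem_support_iff.mp hi (hF i h n)
  have hf : f = ∑ i ∈ F, b i • map k' G (d i) := by
    ext a n
    have : tmul k k' G a n = a • tmul k k' G 1 n := by rw [smul_tmul, mul_one]
    rw [this]
    refine ((f.restrictScalars k').map_smul a _).trans ?_
    refine (congrArg (a • ·) (hsum n)).trans ?_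
    simp only [LinearMap.sum_apply, LinearMap.smul_apply, smul_tmul, map_tmul]
    refine (Finset.smul_sum (r := a) (f := fun i => b i ⊗ₜ[k] c i n) (s := F)).trans
      (Finset.sum_congr rfl fun i _ => ?_)
    exact congrArg (· ⊗ₜ[k] c i n) (show a * b i = b i * (a * 1) by ring)
  rw [hf]
  exact Submodule.sum_mem _ fun i _ => Submodule.smul_mem _ _ (Submodule.subset_span ⟨d i, rfl⟩)

open Pointwise in
/-- Base changes of non-isomorphic indecomposable modules have no common nonzero summand. -/
lemma nonempty_equiv_of_common_retract [Module.Finite k N] [Module.Finite k N']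
    (hN : IsIndecomposableModule (MonoidAlgebra k G) N)
    (hN' : IsIndecomposableModule (MonoidAlgebra k G) N')
    {X : Type*} [AddCommGroup X] [Module (MonoidAlgebra k' G) X] [Nontrivial X]
    (h : IsModuleRetract (MonoidAlgebra k' G) X (GroupBaseChange k k' G N))
    (h' : IsModuleRetract (MonoidAlgebra k' G) X (GroupBaseChange k k' G N')) :
    Nonempty (N ≃ₗ[MonoidAlgebra k G] N') := by
  by_contra hne
  have := hN.1
  have : IsArtinian (MonoidAlgebra k G) N := isArtinian_of_tower k inferInstance
  have : IsNoetherian (MonoidAlgebra k G) N := isNoetherian_of_tower k inferInstance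
  have : Module.Finite k (Module.End (MonoidAlgebra k G) N) := finite_linearMap_of_tower k
  have : IsArtinianRing (Module.End (MonoidAlgebra k G) N) := isArtinian_of_tower k inferInstance
  obtain ⟨n, hn⟩ := hN.exists_nonunits_pow_subset
  let φ : Module.End (MonoidAlgebra k G) N →*
      Module.End (MonoidAlgebra k' G) (GroupBaseChange k k' G N) :=
    { toFun := map k' G
      map_one' := map_id
      map_mul' := map_comp }
  let S := φ '' nonunits _
  have hS : ∀ (α : GroupBaseChange k k' G N →ₗ[MonoidAlgebra k' G] GroupBaseChange k k' G N')
      (β : GroupBaseChange k k' G N' →ₗ[MonoidAlgebra k' G] GroupBaseChange k k' G N),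
      (β ∘ₗ α : Module.End (MonoidAlgebra k' G) (GroupBaseChange k k' G N)) ∈
        Submodule.span k' S := by
    intro α β
    have hα := mem_span_range_map α
    have hβ := mem_span_range_map β
    induction hα using Submodule.span_induction with
    | zero => rw [LinearMap.comp_zero]; exact Submodule.zero_mem _
    | add x y _ _ hx hy => rw [LinearMap.comp_add]; exact Submodule.add_mem _ hx hy
    | smul a x _ hx =>
      have : β ∘ₗ (a • x) = a • (β ∘ₗ x) :=
        LinearMap.ext fun v => (β.restrictScalars k').map_smul a (x v)
      rw [this]
      exact Submodule.smul_mem _ _ hx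
    | mem x hx =>
      obtain ⟨x, rfl⟩ := hx
      induction hβ using Submodule.span_induction with
      | zero => rw [LinearMap.zero_comp]; exact Submodule.zero_mem _
      | add x y _ _ hx hy => rw [LinearMap.add_comp]; exact Submodule.add_mem _ hx hy
      | smul a x _ hx => rw [LinearMap.smul_comp]; exact Submodule.smul_mem _ _ hx
      | mem y hy =>
        obtain ⟨y, rfl⟩ := hy
        rw [← map_comp]
        refine Submodule.subset_span ⟨_, fun hu => hne ?_, rfl⟩
        exact (IsModuleRetract.of_isUnit hu).nonempty_equiv hN'
  obtain ⟨i, p, hip⟩ := h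
  obtain ⟨j, q, hjq⟩ := h'
  have hidem : IsIdempotentElem
      (i ∘ₗ p : Module.End (MonoidAlgebra k' G) (GroupBaseChange k k' G N)) := by
    ext x
    exact congrArg i (LinearMap.congr_fun hip _)
  have hmem : (i ∘ₗ p : Module.End (MonoidAlgebra k' G) (GroupBaseChange k k' G N)) ∈
      Submodule.span k' S := by
    convert hS (j ∘ₗ p) (i ∘ₗ q) using 1
    ext x
    exact congrArg i (LinearMap.congr_fun hjq _).symm
  have hzero : (i ∘ₗ p : Module.End (MonoidAlgebra k' G) (GroupBaseChange k k' G N)) = 0 := by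
    have hpow := Submodule.pow_mem_pow _ hmem (n + 1)
    rw [hidem.pow_succ_eq, Submodule.span_pow, pow_succ, ← Set.image_pow] at hpow
    have hbot : Submodule.span k' (φ '' nonunits _ ^ n * S) = ⊥ := by
      rw [Submodule.span_eq_bot]
      rintro _ ⟨_, ⟨y, hy, rfl⟩, z, -, rfl⟩
      rw [Set.mem_singleton_iff.mp (hn hy)]
      exact (congrArg (· * z) map_zero_hom).trans (zero_mul z)
    rwa [hbot, Submodule.mem_bot] at hpow
  obtain ⟨x, hx⟩ := exists_ne (0 : X)
  apply hx
  have h1 := LinearMap.congr_fun hip x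
  have h2 := congrArg p (LinearMap.congr_fun hzero (i x))
  have h3 := LinearMap.congr_fun hip (p (i x))
  exact (h1.symm.trans h3.symm).trans (h2.trans (map_zero p))

end GroupBaseChange
end BaseChange

lemma nonempty_pi_equiv_pi_fiber {R ι κ : Type*} [Ring R] [Fintype ι] [DecidableEq κ] (c : ι → κ)
    (W : κ → Type*) [∀ q, AddCommGroup (W q)] [∀ q, Module R (W q)] :
    Nonempty ((Π i, W (c i)) ≃ₗ[R] Π q, (Fin (Fintype.card {i // c i = q}) → W q)) := by
  let e₁ := LinearEquiv.piCongrLeft R (fun i => W (c i)) (Equiv.sigmaFiberEquiv c)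
  let e₂ : (Π p : (Σ q, {i // c i = q}), W (c (Equiv.sigmaFiberEquiv c p))) ≃ₗ[R]
      Π p : (Σ q, {i // c i = q}), W p.1 :=
    LinearEquiv.piCongrRight fun p => match p with
      | ⟨_, ⟨i, rfl⟩⟩ => LinearEquiv.refl R (W (c i))
  let e₃ := LinearEquiv.piCurry R (fun (q : κ) (_ : {i // c i = q}) => W q)
  exact ⟨e₁.symm ≪≫ₗ e₂ ≪≫ₗ e₃ ≪≫ₗ LinearEquiv.piCongrRight fun q =>
    LinearEquiv.funCongrLeft R (W q) (Fintype.equivFin _).symm⟩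

lemma coeff_nonneg_of_eventually_eval_nonneg {p : Polynomial ℚ} {d : ℕ} (hd : p.natDegree ≤ d)
    (h : ∃ t₀ : ℕ, ∀ t : ℕ, t₀ ≤ t → 0 ≤ p.eval (t : ℚ)) : 0 ≤ p.coeff d := by
  by_contra! hneg
  have hdeg : p.natDegree = d := le_antisymm hd (Polynomial.le_natDegree_of_ne_zero hneg.ne)
  obtain ⟨t₀, h⟩ := h
  rcases Nat.eq_zero_or_pos d with rfl | hpos
  · rw [Polynomial.eq_C_of_natDegree_eq_zero hdeg] at h
    exact absurd (h t₀ le_rfl) (by simpa using hneg)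
  · have ht := (p.tendsto_atBot_of_leadingCoeff_nonpos
      (Polynomial.natDegree_pos_iff_degree_pos.mp (hdeg ▸ hpos))
      (by rw [Polynomial.leadingCoeff, hdeg]; exact hneg.le)).comp
      (tendsto_natCast_atTop_atTop (R := ℚ))
    obtain ⟨t, ht, ht'⟩ := ((ht.eventually (Filter.eventually_lt_atBot 0)).and
      (Filter.eventually_ge_atTop t₀)).exists
    exact absurd (h t ht') (not_le.mpr ht)

lemma HasPolyDescriptionOfDeg.congr {R : Type u} [Ring R] {M M' : ℕ → Type v}
    [∀ n, AddCommMonoid (M n)] [∀ n, Module R (M n)] [∀ n, AddCommMonoid (M' n)]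
    [∀ n, Module R (M' n)] {d : ℕ} (h : HasPolyDescriptionOfDeg R M d)
    (e : ∀ n, Nonempty (M n ≃ₗ[R] M' n)) : HasPolyDescriptionOfDeg R M' d := by
  obtain ⟨m, hm, s, T, P, h₁, h₂, h₃, h₄, h₅, t₀, h₆⟩ := h
  refine ⟨m, hm, s, T, P, h₁, h₂, h₃, h₄, h₅, t₀, fun t ht a => ?_⟩
  obtain ⟨c, hc, ⟨f⟩⟩ := h₆ t ht a
  exact ⟨c, hc, ⟨(e _).some.symm ≪≫ₗ f⟩⟩

/-- If the elements of `α` are labelled by a finite type in such a way that elements sharing a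
label are related, then `α` has finitely many classes. -/
lemma Setoid.finite_quotient_of_labels {α β : Type*} [Finite β] (r : Setoid α) (L : β → α → Prop)
    (hex : ∀ x, ∃ b, L b x) (hL : ∀ b x y, L b x → L b y → r x y) : Finite (Quotient r) := by
  choose f hf using hex
  refine Finite.of_injective (fun q : Quotient r => f q.out) fun q q' h => ?_
  rw [← Quotient.out_eq q, ← Quotient.out_eq q']
  refine Quotient.sound (hL _ _ _ (hf _) ?_)
  dsimp only at h
  rw [h]
  exact hf _

namespace GroupBaseChange

variable {k k' G : Type*} [Field k] [Field k'] [Algebra k k'] [Group G]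

instance {N : Type*} [AddCommGroup N] [Module k N] [Module (MonoidAlgebra k G) N]
    [IsScalarTower k (MonoidAlgebra k G) N] [Module.Finite k N] :
    Module.Finite k' (GroupBaseChange k k' G N) :=
  inferInstanceAs (Module.Finite k' (k' ⊗[k] N))

lemma finrank_eq (N : Type*) [AddCommGroup N] [Module k N] [Module (MonoidAlgebra k G) N]
    [IsScalarTower k (MonoidAlgebra k G) N] :
    Module.finrank k' (GroupBaseChange k k' G N) = Module.finrank k N :=
  Module.finrank_baseChange

/-- An indecomposable summand of a module whose base change is a product of indecomposable
modules acquires one of these as a summand. -/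
lemma exists_isModuleRetract {N V : Type*} [AddCommGroup N] [Module k N]
    [Module (MonoidAlgebra k G) N] [IsScalarTower k (MonoidAlgebra k G) N] [Module.Finite k N]
    [Nontrivial N] [AddCommGroup V] [Module k V] [Module (MonoidAlgebra k G) V]
    [IsScalarTower k (MonoidAlgebra k G) V]
    (h : IsModuleRetract (MonoidAlgebra k G) N V) {ι : Type*} [Fintype ι] {T : ι → Type*}
    [∀ j, AddCommGroup (T j)] [∀ j, Module (MonoidAlgebra k' G) (T j)]
    (hT : ∀ j, IsIndecomposableModule (MonoidAlgebra k' G) (T j)) {c : ι → ℕ}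
    (e : GroupBaseChange k k' G V ≃ₗ[MonoidAlgebra k' G] Π j, (Fin (c j) → T j)) :
    ∃ j, IsModuleRetract (MonoidAlgebra k' G) (T j) (GroupBaseChange k k' G N) := by
  have hA : IsArtinian (MonoidAlgebra k' G) (GroupBaseChange k k' G N) :=
    isArtinian_of_tower k' inferInstance
  have hN : IsNoetherian (MonoidAlgebra k' G) (GroupBaseChange k k' G N) :=
    isNoetherian_of_tower k' inferInstance
  obtain ⟨κ, _, X, hX, ⟨f⟩⟩ := exists_equiv_pi_indecomposable
    (⊤ : Submodule (MonoidAlgebra k' G) (GroupBaseChange k k' G N))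
  have : Nonempty κ := by
    by_contra hκ
    rw [not_nonempty_iff] at hκ
    have := (Submodule.topEquiv.symm ≪≫ₗ f).toEquiv.subsingleton
    exact not_subsingleton (GroupBaseChange k k' G N) this
  obtain ⟨i⟩ := this
  have hi : IsModuleRetract (MonoidAlgebra k' G) (X i) (GroupBaseChange k k' G N) :=
    (isModuleRetract_pi _ i).trans (.of_equiv (Submodule.topEquiv.symm ≪≫ₗ f).symm)
  have := (hX i).isLocalRing_end
  obtain ⟨j, hj⟩ := ((hi.trans (isModuleRetract k' G h)).trans (.of_equiv e)).exists_of_pi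
  obtain ⟨_, hj⟩ := hj.exists_of_pi
  have := (hX i).1
  obtain ⟨g⟩ := hj.nonempty_equiv (hT j)
  exact ⟨j, (IsModuleRetract.of_equiv g.symm).trans hi⟩

end GroupBaseChange

/-- Polynomial descriptions descend along base change of group algebras. -/
theorem HasPolyDescriptionOfDeg.of_groupBaseChange {k k' G : Type*} [Field k] [Field k']
    [Algebra k k'] [Group G] [Finite G] (V : ℕ → Type*) [∀ n, AddCommGroup (V n)]
    [∀ n, Module k (V n)] [∀ n, Module (MonoidAlgebra k G) (V n)]
    [∀ n, IsScalarTower k (MonoidAlgebra k G) (V n)] [∀ n, Module.Finite k (V n)] {d : ℕ}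
    (h : HasPolyDescriptionOfDeg (MonoidAlgebra k' G) (fun n => GroupBaseChange k k' G (V n)) d) :
    HasPolyDescriptionOfDeg (MonoidAlgebra k G) V d := by
  classical
  obtain ⟨m, hm, s, T, P, hT, hfin, -, hdeg, ⟨a₀, j₀, hP₀, hPd⟩, t₀, h⟩ := h
  let : ∀ j, Module k' (T j) := fun j => Module.compHom (T j) (algebraMap k' (MonoidAlgebra k' G))
  have : ∀ j, IsScalarTower k' (MonoidAlgebra k' G) (T j) :=
    fun j => .of_algebraMap_smul fun _ _ => rfl
  have : ∀ j, Module.Finite k' (T j) := fun j => .trans (MonoidAlgebra k' G) (T j)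
  have : ∀ j, IsArtinian (MonoidAlgebra k' G) (T j) :=
    fun j => isArtinian_of_tower k' inferInstance
  have : ∀ j, IsNoetherian (MonoidAlgebra k' G) (T j) :=
    fun j => isNoetherian_of_tower k' inferInstance
  have := fun j => (hT j).isLocalRing_end
  have := fun j => (hT j).1
  have : ∀ n, IsArtinian (MonoidAlgebra k G) (V n) := fun n => isArtinian_of_tower k inferInstance
  choose ι _ N hN hdec using fun n =>
    exists_equiv_pi_indecomposable (⊤ : Submodule (MonoidAlgebra k G) (V n))
  have := fun n i => (hN n i).1
  have hfinN : ∀ n i, Module.Finite k (N n i) := fun n i =>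
    inferInstanceAs (Module.Finite k ((N n i).restrictScalars k))
  have e : ∀ n, V n ≃ₗ[MonoidAlgebra k G] Π i, N n i :=
    fun n => Submodule.topEquiv.symm ≪≫ₗ (hdec n).some
  -- the indecomposable summands that occur
  let Idx : Type _ := Σ p : {p : ℕ × Fin m // t₀ ≤ p.1}, ι (p.1.1 * m + p.1.2)
  let S (x : Idx) : Submodule (MonoidAlgebra k G) (V (x.1.1.1 * m + x.1.1.2)) := N _ x.2
  let L (j : Fin s) (x : Idx) : Prop :=
    IsModuleRetract (MonoidAlgebra k' G) (T j) (GroupBaseChange k k' G (S x))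
  have hL : ∀ x, ∃ j, L j x := by
    rintro ⟨⟨⟨t, a⟩, ht⟩, i⟩
    obtain ⟨c, -, ⟨f⟩⟩ := h t ht a
    exact GroupBaseChange.exists_isModuleRetract
      ((isModuleRetract_pi _ i).trans (.of_equiv (e _).symm)) hT f
  have hLiso : ∀ j x y, L j x → L j y → Nonempty (S x ≃ₗ[MonoidAlgebra k G] S y) :=
    fun j x y hx hy => GroupBaseChange.nonempty_equiv_of_common_retract (hN _ _) (hN _ _) hx hy
  let r : Setoid Idx :=
    { r := fun x y => Nonempty (S x ≃ₗ[MonoidAlgebra k G] S y)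
      iseqv := ⟨fun x => ⟨.refl _ _⟩, fun ⟨f⟩ => ⟨f.symm⟩, fun ⟨f⟩ ⟨g⟩ => ⟨f ≪≫ₗ g⟩⟩ }
  have hfinQ : Finite (Quotient r) := r.finite_quotient_of_labels L hL hLiso
  let E := Finite.equivFin (Quotient r)
  let rep (q : Fin (Nat.card (Quotient r))) : Idx := (E.symm q).out
  let cls (x : Idx) : Fin (Nat.card (Quotient r)) := E ⟦x⟧
  have hcls : ∀ x, Nonempty (S x ≃ₗ[MonoidAlgebra k G] S (rep (cls x))) := fun x => by
    have : Quotient.mk r x = Quotient.mk r (rep (cls x)) := by simp [rep, cls]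
    exact Quotient.exact this
  have hrep : ∀ q, cls (rep q) = q := fun q => by simp [rep, cls]
  have hrep_inj : ∀ q q', Nonempty (S (rep q) ≃ₗ[MonoidAlgebra k G] S (rep q')) → q = q' := by
    intro q q' hqq
    rw [← hrep q, ← hrep q']
    exact congrArg E (Quotient.sound hqq)
  choose lab hlab using fun q => hL (rep q)
  let c (q) : ℕ := radMult (MonoidAlgebra k' G) k' (T (lab q)) (GroupBaseChange k k' G (S (rep q)))
  have hc : ∀ q, c q ≠ 0 := fun q => radMult_ne_zero k' (hlab q)
  let Q (a : Fin m) (q) : Polynomial ℚ := Polynomial.C ((c q : ℚ)⁻¹) *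
    ∑ j, Polynomial.C (radMult (MonoidAlgebra k' G) k' (T (lab q)) (T j) : ℚ) * P a j
  let mult (t : ℕ) (ht : t₀ ≤ t) (a : Fin m) (q) : ℕ :=
    Fintype.card {i : ι (t * m + a) // cls ⟨⟨(t, a), ht⟩, i⟩ = q}
  have hmult : ∀ (t : ℕ) (ht : t₀ ≤ t) (a : Fin m) q, (Q a q).eval (t : ℚ) = mult t ht a q := by
    intro t ht a q
    obtain ⟨b, hb, ⟨f⟩⟩ := h t ht a
    have h1 : radMult (MonoidAlgebra k' G) k' (T (lab q)) (GroupBaseChange k k' G (V (t * m + a))) =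
        ∑ j, b j * radMult (MonoidAlgebra k' G) k' (T (lab q)) (T j) := by
      rw [radMult_congr k' f, radMult_pi]
      refine Finset.sum_congr rfl fun j _ => ?_
      rw [radMult_pi]
      simp
    have h2 : radMult (MonoidAlgebra k' G) k' (T (lab q)) (GroupBaseChange k k' G (V (t * m + a))) =
        mult t ht a q * c q := by
      rw [radMult_congr k' (GroupBaseChange.congr k' G (e _) ≪≫ₗ GroupBaseChange.piEquiv _),
        radMult_pi]
      have h3 : ∀ i, radMult (MonoidAlgebra k' G) k' (T (lab q))
          (GroupBaseChange k k' G (N (t * m + a) i)) =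
          if cls ⟨⟨(t, a), ht⟩, i⟩ = q then c q else 0 := by
        intro i
        obtain ⟨g⟩ := hcls ⟨⟨(t, a), ht⟩, i⟩
        rw [radMult_congr k' (GroupBaseChange.congr k' G g)]
        split_ifs with hq
        · rw [hq]
        · refine radMult_eq_zero k' fun hret => hq ?_
          exact hrep_inj _ _ (hLiso _ _ _ hret (hlab q))
      rw [Finset.sum_congr rfl fun i _ => h3 i, Finset.sum_ite, Finset.sum_const_zero, add_zero,
        Finset.sum_const, smul_eq_mul]
      simp only [mult, Fintype.card_subtype]
    have hcq : (c q : ℚ) ≠ 0 := Nat.cast_ne_zero.mpr (hc q)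
    rw [h1] at h2
    have h4 : ∑ j, (b j : ℚ) * (radMult (MonoidAlgebra k' G) k' (T (lab q)) (T j) : ℚ) =
        mult t ht a q * c q := by exact_mod_cast h2
    simp only [Q, Polynomial.eval_mul, Polynomial.eval_C, Polynomial.eval_finsetSum, hb]
    rw [inv_mul_eq_iff_eq_mul₀ hcq, mul_comm (c q : ℚ), ← h4]
    exact Finset.sum_congr rfl fun j _ => mul_comm _ _
  have hQV : ∀ (t : ℕ) (ht : t₀ ≤ t) (a : Fin m), Nonempty (V (t * m + a) ≃ₗ[MonoidAlgebra k G]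
      Π q, (Fin (mult t ht a q) → S (rep q))) := by
    intro t ht a
    obtain ⟨f⟩ := nonempty_pi_equiv_pi_fiber (R := MonoidAlgebra k G)
      (fun i : ι (t * m + a) => cls ⟨⟨(t, a), ht⟩, i⟩) (fun q => S (rep q))
    exact ⟨e _ ≪≫ₗ LinearEquiv.piCongrRight (fun i => (hcls ⟨⟨(t, a), ht⟩, i⟩).some) ≪≫ₗ f⟩
  have hQdeg : ∀ a q, (Q a q).natDegree ≤ d := fun a q =>
    (Polynomial.natDegree_C_mul_le _ _).trans <| Polynomial.natDegree_sum_le_of_forall_le _ _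
      fun j _ => (Polynomial.natDegree_C_mul_le _ _).trans (hdeg a j)
  refine ⟨m, hm, _, fun q => ModuleCat.of _ (S (rep q)), Q, fun q => hN _ _, fun q => ?_, ?_,
    hQdeg, ?_, t₀, fun t ht a => ⟨mult t ht a, hmult t ht a, hQV t ht a⟩⟩
  · exact Module.Finite.of_restrictScalars_finite k _ _
  · intro q
    obtain ⟨⟨⟨⟨t, a⟩, ht⟩, i⟩, hx⟩ : ∃ x, rep q = x := ⟨_, rfl⟩
    refine ⟨a, fun h0 => ?_⟩
    have h1 := hmult t ht a q
    rw [h0, Polynomial.eval_zero, eq_comm, Nat.cast_eq_zero, Fintype.card_eq_zero_iff] at h1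
    exact h1.elim ⟨i, by rw [← hx, hrep]⟩
  · -- compare dimensions
    let A : Polynomial ℚ := ∑ j, Polynomial.C (Module.finrank k' (T j) : ℚ) * P a₀ j
    let B : Polynomial ℚ := ∑ q, Polynomial.C (Module.finrank k (S (rep q)) : ℚ) * Q a₀ q
    have hAB : A = B := by
      refine Polynomial.eq_of_infinite_eval_eq _ _ (Set.Infinite.mono ?_
        ((Set.Ici_infinite t₀).image (f := fun n : ℕ => (n : ℚ)) Nat.cast_injective.injOn))
      rintro _ ⟨t, ht, rfl⟩
      obtain ⟨b, hb, ⟨f⟩⟩ := h t ht a₀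
      obtain ⟨g⟩ := hQV t ht a₀
      have h1 := (f.restrictScalars k').finrank_eq
      have h2 := (g.restrictScalars k).finrank_eq
      rw [GroupBaseChange.finrank_eq, h2] at h1
      simp only [Module.finrank_pi_fintype, Finset.sum_const, Finset.card_univ, Fintype.card_fin,
        smul_eq_mul] at h1
      have h3 : ∑ q, (mult t ht a₀ q : ℚ) * (Module.finrank k (S (rep q)) : ℚ) =
        ∑ j, (b j : ℚ) * (Module.finrank k' (T j) : ℚ) := by exact_mod_cast h1
      simp only [Set.mem_ofPred_eq, A, B, Polynomial.eval_finsetSum, Polynomial.eval_mul,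
        Polynomial.eval_C, hb, hmult t ht]
      simp only [mul_comm (Module.finrank _ _ : ℚ)]
      exact h3.symm
    have hApos : 0 < A.coeff d := by
      simp only [A, Polynomial.finsetSum_coeff, Polynomial.coeff_C_mul]
      have hnn : ∀ j, 0 ≤ (P a₀ j).coeff d := fun j =>
        coeff_nonneg_of_eventually_eval_nonneg (hdeg a₀ j) ⟨t₀, fun t ht => by
          obtain ⟨b, hb, -⟩ := h t ht a₀
          rw [hb]
          exact Nat.cast_nonneg _⟩
      refine Finset.sum_pos' (fun j _ => mul_nonneg (Nat.cast_nonneg _) (hnn j))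
        ⟨j₀, Finset.mem_univ _, mul_pos (Nat.cast_pos.mpr Module.finrank_pos)
          (lt_of_le_of_ne (hnn j₀) ?_)⟩
      rw [← hPd]
      exact (Polynomial.leadingCoeff_ne_zero.mpr hP₀).symm
    have hB : ∃ q, (Q a₀ q).coeff d ≠ 0 := by
      by_contra! hall
      rw [hAB] at hApos
      simp [B, hall] at hApos
    obtain ⟨q, hq⟩ := hB
    exact ⟨a₀, q, fun h0 => hq (by rw [h0, Polynomial.coeff_zero]),
      le_antisymm (hQdeg a₀ q) (Polynomial.le_natDegree_of_ne_zero hq)⟩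

/-- Let `k ⊆ k'` be an algebraic field extension and `G` a finite group.  If a
sequence `(M n)` of finite-dimensional `kG`-modules is such that `(k' ⊗_k M n)` admits a
polynomial description of degree `d` over `k'G`, then `(M n)` admits a polynomial
description of degree `d` over `kG`. -/
theorem stmt_8 (k k' G : Type*) [Field k] [Field k'] [Algebra k k']
    [Algebra.IsAlgebraic k k'] [Group G] [Finite G]
    (M : ℕ → Type*) [∀ n, AddCommGroup (M n)] [∀ n, Module k (M n)]
    [∀ n, Module.Finite k (M n)]
    (ρ : ∀ n, Representation k G (M n)) (d : ℕ)
    (h : HasPolyDescriptionOfDeg (MonoidAlgebra k' G)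
      (fun n => (repBaseChange k' (ρ n)).asModule) d) :
    HasPolyDescriptionOfDeg (MonoidAlgebra k G) (fun n => (ρ n).asModule) d := by
  have h' := h.congr fun n => GroupBaseChange.nonempty_equiv_asModule (k' := k') (ρ n)
  exact HasPolyDescriptionOfDeg.of_groupBaseChange _ h'
end
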